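/- There exists a polynomial poly_7 such that for every 1-VASS with disequality tests V=(Q,D,Δ,w) (with single disequality guards) the following holds: if (q,z),(q',z') ∈ Conf_+, there is a valid run over a primitive path π from (q,z) to (q',z'), and (q',z') ∈ U_n for some n ∈ ℕ, then there is a valid run of length at most poly_7(|Q|) from (q,z) to some configuration (q',z'') with (q',z'') ∈ U_n. -/

import Mathlib

namespace VASSPaper

/-- A 1-VASS with disequality tests: states `Q`, transition relation `delta`,
integer weights `w`, and for each state a cofinite set `D q ⊆ ℕ` of allowed counter values. -/
structure OneVASS (Q : Type) where
  delta : Q → Q → Prop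
  w : Q → Q → ℤ
  D : Q → Set ℕ
  cofinite : ∀ q, (D q)ᶜ.Finite

variable {Q : Type}

/-- A path is a nonempty sequence of states joined by transitions. -/
def IsPath (V : OneVASS Q) : List Q → Prop
  | [] => False
  | [_] => True
  | a :: b :: l => V.delta a b ∧ IsPath V (b :: l)

/-- The weight of a path: the sum of the weights of its transitions. -/
def pathWeight (V : OneVASS Q) (π : List Q) : ℤ :=
  (List.zipWith V.w π π.tail).sum

/-- The counter value at position `i` of the run over `π` starting with counter `z`. -/
def counterAt (V : OneVASS Q) (z : ℕ) (π : List Q) (i : ℕ) : ℤ :=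
  (z : ℤ) + pathWeight V (π.take (i + 1))

/-- `π` lifts to a run from counter value `z`: all counter values stay nonnegative. -/
def IsRun (V : OneVASS Q) (π : List Q) (z : ℕ) : Prop :=
  IsPath V π ∧ ∀ i, i < π.length → 0 ≤ counterAt V z π i

/-- A valid run additionally respects all disequality guards. -/
def IsValidRun (V : OneVASS Q) (π : List Q) (z : ℕ) : Prop :=
  IsRun V π z ∧ ∀ i, ∀ h : i < π.length, (counterAt V z π i).toNat ∈ V.D (π.get ⟨i, h⟩)

/-- `π` goes from configuration `c` to configuration `c'`. -/
def RunFromTo (V : OneVASS Q) (π : List Q) (c c' : Q × ℕ) : Prop :=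
  π.head? = some c.1 ∧ π.getLast? = some c'.1 ∧ (c'.2 : ℤ) = (c.2 : ℤ) + pathWeight V π

/-- `c'` is reachable from `c` by a valid run. -/
def Reaches (V : OneVASS Q) (c c' : Q × ℕ) : Prop :=
  ∃ π, IsValidRun V π c.2 ∧ RunFromTo V π c c'

/-- A configuration is unbounded if infinitely many configurations are reachable from it. -/
def Unbounded (V : OneVASS Q) (c : Q × ℕ) : Prop :=
  {c' | Reaches V c c'}.Infinite

/-- `(s,0)` covers the state `t`. -/
def Covers (V : OneVASS Q) (s t : Q) : Prop :=
  ∃ z, Reaches V (s, 0) (t, z)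

/-- Every state has at most one disequality guard. -/
def SingleGuard (V : OneVASS Q) : Prop :=
  ∀ q, V.D q = Set.univ ∨ ∃ g : ℕ, V.D q = {g}ᶜ

/-- The minimum weight of a (possibly empty) prefix of `π`. -/
def pmin (V : OneVASS Q) (π : List Q) : ℤ :=
  ((List.range (π.length + 1)).map fun i => pathWeight V (π.take i)).foldr min 0

/-- The maximum weight of a (possibly empty) suffix of `π`. -/
def smax (V : OneVASS Q) (π : List Q) : ℤ :=
  ((List.range (π.length + 1)).map fun i => pathWeight V (π.drop i)).foldr max 0

/-- A cycle on `q`: a path with at least one transition starting and ending at `q`. -/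
def IsCycleOn (V : OneVASS Q) (π : List Q) (q : Q) : Prop :=
  IsPath V π ∧ 2 ≤ π.length ∧ π.head? = some q ∧ π.getLast? = some q

/-- A simple cycle on `q`. -/
def IsSimpleCycleOn (V : OneVASS Q) (π : List Q) (q : Q) : Prop :=
  IsCycleOn V π q ∧ π.dropLast.Nodup

/-- The set of states lying on a positive-weight simple cycle. -/
def Qplus (V : OneVASS Q) : Set Q :=
  {q | ∃ π, IsSimpleCycleOn V π q ∧ 0 < pathWeight V π}

/-- `γ` is a valid choice of cycles: for each `q ∈ Q₊`, `γ q` is a simple positive cycle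
on `q` whose `pmin` is maximal among all positive-weight simple cycles on `q`. -/
def GammaChoice (V : OneVASS Q) (γ : Q → List Q) : Prop :=
  ∀ q ∈ Qplus V,
    IsSimpleCycleOn V (γ q) q ∧ 0 < pathWeight V (γ q) ∧
      ∀ π, IsSimpleCycleOn V π q → 0 < pathWeight V π → pmin V π ≤ pmin V (γ q)

/-- `Conf₊`: configurations `(q,z)` with `q ∈ Q₊` and `z + pmin (γ q) ≥ 0`. -/
def ConfPlus (V : OneVASS Q) (γ : Q → List Q) : Set (Q × ℕ) :=
  {c | c.1 ∈ Qplus V ∧ 0 ≤ (c.2 : ℤ) + pmin V (γ c.1)}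

/-- `W_q`, the weight of the chosen cycle `γ q`, as a natural number. -/
def Wnat (V : OneVASS Q) (γ : Q → List Q) (q : Q) : ℕ :=
  (pathWeight V (γ q)).toNat

/-- The `q`-residue class of `r` modulo `W_q`. -/
def resClass (V : OneVASS Q) (γ : Q → List Q) (q : Q) (r : ℕ) : Set (Q × ℕ) :=
  {c | c ∈ ConfPlus V γ ∧ c.1 = q ∧ c.2 % Wnat V γ q = r}

/-- `iterCycle π k` is the cycle `π` iterated `k+1` times. -/
def iterCycle (π : List Q) : ℕ → List Q
  | 0 => π
  | k + 1 => iterCycle π k ++ π.tail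

/-- Counter values `z < z'` at state `q` are connected by a valid run iterating `γ q`. -/
def chainLinked (V : OneVASS Q) (γ : Q → List Q) (q : Q) (z z' : ℕ) : Prop :=
  ∃ k, IsValidRun V (iterCycle (γ q) k) z ∧
    (z' : ℤ) = (z : ℤ) + pathWeight V (iterCycle (γ q) k)

/-- Any two configurations of `S` are connected by iterating `γ q`. -/
def ChainCond (V : OneVASS Q) (γ : Q → List Q) (q : Q) (S : Set (Q × ℕ)) : Prop :=
  ∀ c ∈ S, ∀ c' ∈ S, c.2 < c'.2 → chainLinked V γ q c.2 c'.2

/-- A `q`-chain inside the `q`-residue class of `r`: a maximal subset whose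
configurations are pairwise connected by iterating `γ q`. -/
def IsChainIn (V : OneVASS Q) (γ : Q → List Q) (q : Q) (r : ℕ) (C : Set (Q × ℕ)) : Prop :=
  C ⊆ resClass V γ q r ∧ ChainCond V γ q C ∧
    ∀ C', C ⊆ C' → C' ⊆ resClass V γ q r → ChainCond V γ q C' → C' = C

/-- A chain (in some residue class of some state of `Q₊`). -/
def IsChain (V : OneVASS Q) (γ : Q → List Q) (C : Set (Q × ℕ)) : Prop :=
  ∃ q r, q ∈ Qplus V ∧ r < Wnat V γ q ∧ IsChainIn V γ q r C

/-- A set of configurations is bounded if its counter values are bounded. -/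
def chainBounded (C : Set (Q × ℕ)) : Prop :=
  BddAbove (Prod.snd '' C)

/-- A residue class is trivial if it consists of a single unbounded chain. -/
def TrivialClass (V : OneVASS Q) (γ : Q → List Q) (q : Q) (r : ℕ) : Prop :=
  IsChainIn V γ q r (resClass V γ q r) ∧ ¬ chainBounded (resClass V γ q r)

/-- There is a valid run of length `k` (i.e. `k` transitions) from `c` into the set `S`. -/
def RunLenTo (V : OneVASS Q) (c : Q × ℕ) (S : Set (Q × ℕ)) (k : ℕ) : Prop :=
  ∃ π c', c' ∈ S ∧ IsValidRun V π c.2 ∧ RunFromTo V π c c' ∧ π.length = k + 1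

/-- Configurations of `Conf₊ \ Un` whose distance to `Un` is minimal among all
configurations of `Conf₊ \ Un`. -/
def Uprime (V : OneVASS Q) (γ : Q → List Q) (Un : Set (Q × ℕ)) : Set (Q × ℕ) :=
  {c | c ∈ ConfPlus V γ \ Un ∧
    ∃ k, RunLenTo V c Un k ∧
      ∀ c' ∈ ConfPlus V γ \ Un, ∀ j, RunLenTo V c' Un j → k ≤ j}

/-- `S` is downward closed in every chain. -/
def dcClosed (V : OneVASS Q) (γ : Q → List Q) (S : Set (Q × ℕ)) : Prop :=
  ∀ C, IsChain V γ C → ∀ c ∈ S ∩ C, ∀ c' ∈ C, c'.2 ≤ c.2 → c' ∈ S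

/-- The inductive sequence `U_n`: `U_0` is the union of the unbounded chains; `U_{n+1}` is the
smallest superset of `U_n ∪ U'_n` that is downward closed in every chain. -/
def U (V : OneVASS Q) (γ : Q → List Q) : ℕ → Set (Q × ℕ)
  | 0 => ⋃₀ {C | IsChain V γ C ∧ ¬ chainBounded C}
  | n + 1 => ⋂₀ {S | U V γ n ∪ Uprime V γ (U V γ n) ⊆ S ∧ dcClosed V γ S}

/-- `C` is an `n`-active bounded chain in the `q`-residue class of `r`. -/
def nActiveIn (V : OneVASS Q) (γ : Q → List Q) (q : Q) (r : ℕ) (n : ℕ)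
    (C : Set (Q × ℕ)) : Prop :=
  IsChainIn V γ q r C ∧ chainBounded C ∧
    ∃ c ∈ U V γ n ∩ resClass V γ q r, ∃ c' ∈ C, c.2 ≤ c'.2

/-- `δ_n(C)` for a `q`-chain `C`: configurations outside `U_n` whose counter value lies
between two counter values of `C \ U_n`. -/
def deltaC (V : OneVASS Q) (γ : Q → List Q) (n : ℕ) (q : Q) (C : Set (Q × ℕ)) :
    Set (Q × ℕ) :=
  {c | c ∈ ConfPlus V γ ∧ c.1 = q ∧ c ∉ U V γ n ∧
    ∃ z₁ z₂, (q, z₁) ∈ C \ U V γ n ∧ (q, z₂) ∈ C \ U V γ n ∧ z₁ ≤ c.2 ∧ c.2 ≤ z₂}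

/-- `δ_n(R)` for the `q`-residue class `R` of `r`: union of `δ_n(C)` over `n`-active chains. -/
def deltaR (V : OneVASS Q) (γ : Q → List Q) (n : ℕ) (q : Q) (r : ℕ) : Set (Q × ℕ) :=
  {c | ∃ C, nActiveIn V γ q r n C ∧ c ∈ deltaC V γ n q C}

/-- A positive-weight cycle (as a list of states). -/
def IsPosCycle (V : OneVASS Q) (π : List Q) : Prop :=
  2 ≤ π.length ∧ π.head? = π.getLast? ∧ 0 < pathWeight V π

/-- A path is primitive if no proper infix of it is a positive-weight cycle. -/
def Primitive (V : OneVASS Q) (π : List Q) : Prop :=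
  ∀ i l, (π.drop i).take l ≠ π → ¬ IsPosCycle V ((π.drop i).take l)



/-- The run from `(a, y)` along the states `l` satisfies `P` at every configuration. -/
def RunP (V : OneVASS Q) (P : Q → ℤ → Prop) : Q → List Q → ℤ → Prop
  | a, [], y => P a y
  | a, b :: l, y => P a y ∧ V.delta a b ∧ RunP V P b l (y + V.w a b)

/-- The last state of the path `a :: l`. -/
def endS : Q → List Q → Q
  | a, [] => a
  | _, b :: l => endS b l

/-- The weight of the path `a :: l`. -/
def wt (V : OneVASS Q) : Q → List Q → ℤ
  | _, [] => 0
  | a, b :: l => V.w a b + wt V b l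

/-- The counter value is nonnegative. -/
def nn : Q → ℤ → Prop := fun _ y => 0 ≤ y

/-- The configuration is valid. -/
def ok (V : OneVASS Q) : Q → ℤ → Prop := fun a y => 0 ≤ y ∧ y.toNat ∈ V.D a

theorem pathWeight_cons (V : OneVASS Q) (a : Q) (l : List Q) :
    pathWeight V (a :: l) = wt V a l := by
  induction l generalizing a with
  | nil => simp [pathWeight, wt]
  | cons b l ih =>
    have := ih b
    simp only [pathWeight, wt, List.tail_cons, List.zipWith_cons_cons, List.sum_cons] at this ⊢
    rw [this]

theorem getLast?_cons_eq_endS (a : Q) (l : List Q) :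
    (a :: l).getLast? = some (endS a l) := by
  induction l generalizing a with
  | nil => rfl
  | cons b l ih => rw [List.getLast?_cons_cons, ih b]; rfl

theorem endS_append (a : Q) (l l' : List Q) :
    endS a (l ++ l') = endS (endS a l) l' := by
  induction l generalizing a with
  | nil => rfl
  | cons b l ih => exact ih b

theorem wt_append (V : OneVASS Q) (a : Q) (l l' : List Q) :
    wt V a (l ++ l') = wt V a l + wt V (endS a l) l' := by
  induction l generalizing a with
  | nil => simp [wt, endS]
  | cons b l ih => simp [wt, endS, ih b, add_assoc]

theorem RunP.head {V : OneVASS Q} {P : Q → ℤ → Prop} {a : Q} {l : List Q} {y : ℤ}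
    (h : RunP V P a l y) : P a y := by
  cases l with
  | nil => exact h
  | cons b l => exact h.1

theorem runP_append {V : OneVASS Q} {P : Q → ℤ → Prop} {a : Q} {l l' : List Q} {y : ℤ} :
    RunP V P a (l ++ l') y ↔ RunP V P a l y ∧ RunP V P (endS a l) l' (y + wt V a l) := by
  induction l generalizing a y with
  | nil => simpa [wt, endS, RunP] using fun h => RunP.head h
  | cons b l ih => simp [wt, endS, RunP, ih, and_assoc, add_assoc]

theorem RunP.imp {V : OneVASS Q} {P P' : Q → ℤ → Prop} (hP : ∀ a y, P a y → P' a y) {a : Q}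
    {l : List Q} {y : ℤ} (h : RunP V P a l y) : RunP V P' a l y := by
  induction l generalizing a y with
  | nil => exact hP _ _ h
  | cons b l ih => exact ⟨hP _ _ h.1, h.2.1, ih h.2.2⟩

theorem RunP.mono {V : OneVASS Q} {a : Q} {l : List Q} {y y' : ℤ}
    (h : RunP V nn a l y) (hy : y ≤ y') : RunP V nn a l y' := by
  induction l generalizing a y y' with
  | nil => exact le_trans h hy
  | cons b l ih => exact ⟨le_trans h.1 hy, h.2.1, ih h.2.2 (by omega)⟩

theorem runP_iff {V : OneVASS Q} {P : Q → ℤ → Prop} {a : Q} {l : List Q} {y : ℤ} :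
    RunP V P a l y ↔ IsPath V (a :: l) ∧
      ∀ i, ∀ h : i < (a :: l).length,
        P ((a :: l).get ⟨i, h⟩) (y + pathWeight V ((a :: l).take (i + 1))) := by
  induction l generalizing a y with
  | nil =>
    simp only [RunP, IsPath, true_and]
    constructor
    · intro h i hi
      have : i = 0 := by simpa using hi
      subst this
      simpa [pathWeight] using h
    · intro h
      simpa [pathWeight] using h 0 (by simp)
  | cons b l ih =>
    simp only [RunP, IsPath, ih]
    constructor
    · rintro ⟨h1, h2, h3, h4⟩
      refine ⟨⟨h2, h3⟩, fun i hi => ?_⟩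
      cases i with
      | zero => simpa [pathWeight] using h1
      | succ i =>
        have := h4 i (by simpa using hi)
        simp only [List.take_succ_cons, pathWeight_cons, wt] at this ⊢
        rw [← add_assoc]; exact this
    · rintro ⟨⟨h2, h3⟩, h4⟩
      refine ⟨by simpa [pathWeight] using h4 0 (by simp), h2, h3, fun i hi => ?_⟩
      have := h4 (i + 1) (by simpa using hi)
      simp only [List.take_succ_cons, pathWeight_cons, wt] at this ⊢
      rw [← add_assoc] at this; exact this

theorem isValidRun_iff {V : OneVASS Q} {a : Q} {l : List Q} {z : ℕ} :
    IsValidRun V (a :: l) z ↔ RunP V (ok V) a l z := by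
  rw [runP_iff, IsValidRun, IsRun]
  constructor
  · rintro ⟨⟨h1, h2⟩, h3⟩
    exact ⟨h1, fun i hi => ⟨h2 i hi, h3 i hi⟩⟩
  · rintro ⟨h1, h2⟩
    exact ⟨⟨h1, fun i hi => (h2 i hi).1⟩, fun i hi => (h2 i hi).2⟩

theorem runFromTo_iff {V : OneVASS Q} {a : Q} {l : List Q} {c c' : Q × ℕ} :
    RunFromTo V (a :: l) c c' ↔ a = c.1 ∧ endS a l = c'.1 ∧ (c'.2 : ℤ) = c.2 + wt V a l := by
  simp [RunFromTo, getLast?_cons_eq_endS, pathWeight_cons]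

/-- Each guard along a path blocks at most one starting value. -/
theorem exists_blocked {V : OneVASS Q} (hV : SingleGuard V) {a : Q} {l : List Q} {y₀ : ℤ}
    (h : RunP V nn a l y₀) :
    ∃ G : Finset ℤ, G.card ≤ l.length + 1 ∧ ∀ y, y₀ ≤ y → y ∉ G → RunP V (ok V) a l y := by
  classical
  have key : ∀ a : Q, ∃ g : ℤ, ∀ y, 0 ≤ y → y ≠ g → ok V a y := by
    intro a
    rcases hV a with h | ⟨g, h⟩
    · exact ⟨0, fun y hy _ => ⟨hy, by simp [h]⟩⟩
    · refine ⟨g, fun y hy hg => ⟨hy, ?_⟩⟩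
      rw [h, Set.mem_compl_singleton_iff]; omega
  induction l generalizing a y₀ with
  | nil =>
    obtain ⟨g, hg⟩ := key a
    exact ⟨{g}, by simp, fun y hy hyG => hg y (le_trans h hy) (by simpa using hyG)⟩
  | cons b l ih =>
    obtain ⟨g, hg⟩ := key a
    obtain ⟨G, hG, hr⟩ := ih h.2.2
    refine ⟨insert g (G.image fun x => x - V.w a b), ?_, fun y hy hyG => ?_⟩
    · refine (Finset.card_insert_le _ _).trans ?_
      have := Finset.card_image_le (s := G) (f := fun x => x - V.w a b)
      simp only [List.length_cons]; omega
    · rw [Finset.mem_insert, Finset.mem_image] at hyG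
      push Not at hyG
      refine ⟨hg y (le_trans h.1 hy) hyG.1, h.2.1, hr _ (by omega) fun hm => ?_⟩
      exact hyG.2 _ hm (by ring)

/-- `s j`, `v j` (for `j ≤ m`) are the states and counter values along a run. -/
structure Seq (V : OneVASS Q) (P : Q → ℤ → Prop) (m : ℕ) (s : ℕ → Q) (v : ℕ → ℤ) : Prop where
  delta : ∀ j < m, V.delta (s j) (s (j + 1))
  val : ∀ j < m, v (j + 1) = v j + V.w (s j) (s (j + 1))
  inv : ∀ j ≤ m, P (s j) (v j)

theorem RunP.exists_seq {V : OneVASS Q} {P : Q → ℤ → Prop} {a : Q} {l : List Q} {y : ℤ}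
    (h : RunP V P a l y) :
    ∃ s v, Seq V P l.length s v ∧ s 0 = a ∧ v 0 = y ∧ s l.length = endS a l ∧
      v l.length = y + wt V a l ∧
      ∀ i j, i ≤ j → j ≤ l.length → pathWeight V (((a :: l).drop i).take (j - i + 1)) = v j - v i ∧
        (((a :: l).drop i).take (j - i + 1)).head? = some (s i) ∧
        (((a :: l).drop i).take (j - i + 1)).getLast? = some (s j) ∧
        (((a :: l).drop i).take (j - i + 1)).length = j - i + 1 := by
  induction l generalizing a y with
  | nil =>
    refine ⟨fun _ => a, fun _ => y, ⟨by simp, by simp, fun _ _ => h⟩, rfl, rfl, rfl,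
      by simp [wt], fun i j hij hj => ?_⟩
    have hj : j = 0 := by simpa using hj
    have hi : i = 0 := by omega
    subst hj hi
    simp [pathWeight]
  | cons b l ih =>
    obtain ⟨s, v, hs, h0, hv0, hl, hvl, hw⟩ := ih h.2.2
    refine ⟨fun j => Nat.casesOn j a s, fun j => Nat.casesOn j y v, ⟨?_, ?_, ?_⟩, rfl, rfl, ?_, ?_,
      ?_⟩
    · rintro (_ | j) hj
      · simpa [h0] using h.2.1
      · exact hs.delta j (by simpa using hj)
    · rintro (_ | j) hj
      · simp [h0, hv0]
      · exact hs.val j (by simpa using hj)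
    · rintro (_ | j) hj
      · exact h.1
      · exact hs.inv j (by simpa using hj)
    · simpa [endS] using hl
    · simp [hvl, wt, add_assoc]
    · rintro (_ | i) (_ | j) hij hj
      · simp [pathWeight]
      · obtain ⟨h1, h2, h3, h4⟩ := hw 0 j (by omega) (by simpa using hj)
        simp only [List.drop_zero, Nat.sub_zero, List.take_succ_cons, pathWeight_cons, wt,
          List.head?_cons, List.length_cons, getLast?_cons_eq_endS, endS] at *
        refine ⟨?_, rfl, h3, by omega⟩
        show _ = v j - y
        omega
      · omega
      · obtain ⟨h1, h2, h3, h4⟩ := hw i j (by omega) (by simpa using hj)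
        simp only [List.drop_succ_cons, Nat.reduceSubDiff]
        exact ⟨h1, h2, h3, h4⟩

theorem Seq.shift {V : OneVASS Q} {P : Q → ℤ → Prop} {m : ℕ} {s : ℕ → Q} {v : ℕ → ℤ}
    (h : Seq V P m s v) {i : ℕ} (hi : i ≤ m) :
    Seq V P (m - i) (fun j => s (i + j)) (fun j => v (i + j)) :=
  ⟨fun j hj => h.delta (i + j) (by omega), fun j hj => h.val (i + j) (by omega),
    fun j hj => h.inv (i + j) (by omega)⟩

theorem Seq.imp {V : OneVASS Q} {P P' : Q → ℤ → Prop} (hP : ∀ a y, P a y → P' a y) {m : ℕ}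
    {s : ℕ → Q} {v : ℕ → ℤ} (h : Seq V P m s v) : Seq V P' m s v :=
  ⟨h.delta, h.val, fun j hj => hP _ _ (h.inv j hj)⟩

theorem Seq.take {V : OneVASS Q} {P : Q → ℤ → Prop} {m m' : ℕ} {s : ℕ → Q} {v : ℕ → ℤ}
    (h : Seq V P m s v) (hm : m' ≤ m) : Seq V P m' s v :=
  ⟨fun j hj => h.delta j (by omega), fun j hj => h.val j (by omega),
    fun j hj => h.inv j (by omega)⟩

theorem Seq.exists_run {V : OneVASS Q} {P : Q → ℤ → Prop} {m : ℕ} {s : ℕ → Q} {v : ℕ → ℤ}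
    (h : Seq V P m s v) :
    ∃ l, RunP V P (s 0) l (v 0) ∧ endS (s 0) l = s m ∧ wt V (s 0) l = v m - v 0 ∧
      l.length = m := by
  induction m with
  | zero => exact ⟨[], h.inv 0 le_rfl, rfl, by simp [wt], rfl⟩
  | succ m ih =>
    obtain ⟨l, h1, h2, h3, h4⟩ := ih (h.take (Nat.le_succ m))
    have hv := h.val m (by omega)
    refine ⟨l ++ [s (m + 1)], runP_append.2 ⟨h1, ?_⟩, ?_, ?_, by simp [h4]⟩
    · rw [h2, h3]
      refine ⟨by simpa using h.inv m (by omega), h.delta m (by omega), ?_⟩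
      have := h.inv (m + 1) le_rfl
      rw [hv] at this
      simpa [RunP] using this
    · rw [endS_append]; rfl
    · rw [wt_append, h2, h3, hv]; simp [wt]; ring

/-- Jumping from each position to the last one with the same key removes only nonpositive
cycles. -/
theorem Seq.compress {V : OneVASS Q} {m : ℕ} {s : ℕ → Q} {v : ℕ → ℤ} (h : Seq V nn m s v)
    {ι : Type} [DecidableEq ι] (κ : ℕ → ι) (W : ℤ) (i : ℕ) (hi : i ≤ m)
    (hκ : ∀ a b, i ≤ a → a < b → b ≤ m → κ a = κ b → s a = s b ∧ v b ≤ v a ∧ W ∣ v b - v a) :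
    ∃ l, RunP V nn (s i) l (v i) ∧ endS (s i) l = s m ∧ v m - v i ≤ wt V (s i) l ∧
      W ∣ wt V (s i) l - (v m - v i) ∧ l.length + 1 ≤ ((Finset.Icc i m).image κ).card ∧
      l.length ≤ m - i ∧ (∀ x ∈ s i :: l, ∃ j, i ≤ j ∧ j ≤ m ∧ x = s j) ∧
      ((∀ a b, s a = s b → κ a = κ b) → (s i :: l).Nodup) := by
  induction hk : m - i using Nat.strong_induction_on generalizing i with
  | _ k ih =>
  obtain ⟨i', hi', hmax⟩ := ((Finset.Icc i m).filter fun j => κ j = κ i).exists_max_image id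
    ⟨i, by simp [hi]⟩
  simp only [Finset.mem_filter, Finset.mem_Icc, id] at hi' hmax
  have hii : s i = s i' ∧ v i' ≤ v i ∧ W ∣ v i' - v i := by
    rcases eq_or_lt_of_le hi'.1.1 with he | hlt
    · simp [← he]
    · exact hκ i i' le_rfl hlt hi'.1.2 hi'.2.symm
  rcases eq_or_lt_of_le hi'.1.2 with rfl | hlt
  · refine ⟨[], h.inv i hi, hii.1, by simpa [wt] using hii.2.1, ?_, ?_, by simp, ?_, by simp⟩
    · have : wt V (s i) [] - (v i' - v i) = -(v i' - v i) := by simp [wt]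
      rw [this]; exact (dvd_neg).2 hii.2.2
    · simpa using hi
    · intro x hx
      exact ⟨i, le_rfl, hi, by simpa using hx⟩
  · obtain ⟨l, h1, h2, h3, h4, h5, h6, h7, h8⟩ := ih (m - (i' + 1)) (by omega) (i' + 1) hlt
      (fun a b ha => hκ a b (by omega)) rfl
    have hv := h.val i' hlt
    rw [← hii.1] at hv
    refine ⟨s (i' + 1) :: l, ⟨h.inv i hi, ?_, h1.mono (by omega)⟩, h2, ?_, ?_, ?_, ?_, ?_, ?_⟩
    · rw [hii.1]; exact h.delta i' hlt
    · simp only [wt]; linarith [hii.2.1]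
    · have : wt V (s i) (s (i' + 1) :: l) - (v m - v i) =
          (wt V (s (i' + 1)) l - (v m - v (i' + 1))) - (v i' - v i) := by
        simp only [wt]; rw [hv]; ring
      rw [this]; exact dvd_sub h4 hii.2.2
    · have hss : insert (κ i) ((Finset.Icc (i' + 1) m).image κ) ⊆ (Finset.Icc i m).image κ := by
        intro x hx
        simp only [Finset.mem_insert, Finset.mem_image, Finset.mem_Icc] at hx ⊢
        rcases hx with rfl | ⟨j, hj, rfl⟩
        · exact ⟨i, ⟨le_rfl, hi⟩, rfl⟩
        · exact ⟨j, by omega, rfl⟩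
      have := Finset.card_le_card hss
      rw [Finset.card_insert_of_notMem] at this
      · simp only [List.length_cons]; omega
      · simp only [Finset.mem_image, Finset.mem_Icc, not_exists, not_and]
        intro j hj hje
        have := hmax j ⟨by omega, hje⟩
        omega
    · simp only [List.length_cons]; omega
    · intro x hx
      rcases List.mem_cons.1 hx with rfl | hx
      · exact ⟨i, le_rfl, hi, rfl⟩
      · obtain ⟨j, hj1, hj2, rfl⟩ := h7 x hx
        exact ⟨j, by omega, hj2, rfl⟩
    · intro hinj
      refine List.nodup_cons.2 ⟨fun hx => ?_, h8 hinj⟩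
      obtain ⟨j, hj1, hj2, hj⟩ := h7 _ hx
      have := hmax j ⟨by omega, (hinj _ _ hj).symm⟩
      omega

/-- `l` continues `a` to a path ending in `c` of length at most `N` that is a run from `y`
reaching at least the value `e`. -/
def Short (V : OneVASS Q) (a c : Q) (y e : ℤ) (N : ℕ) (l : List Q) : Prop :=
  RunP V nn a l y ∧ endS a l = c ∧ e ≤ y + wt V a l ∧ l.length ≤ N

theorem Short.of_append {V : OneVASS Q} {a b c : Q} {x y y' e : ℤ} {N N' : ℕ} {l l' : List Q}
    (h : Short V a b x y N l) (h' : Short V b c y' e N' l') (hy : y' ≤ y) :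
    Short V a c x e (N + N') (l ++ l') := by
  obtain ⟨h1, h2, h3, h4⟩ := h
  obtain ⟨h1', h2', h3', h4'⟩ := h'
  subst h2
  refine ⟨runP_append.2 ⟨h1, h1'.mono (by omega)⟩, by rw [endS_append, h2'], ?_, ?_⟩
  · rw [wt_append]; omega
  · rw [List.length_append]; omega

/-- A path without positive proper infix cycles can be shortened either preserving the weight
modulo `W`, or in many ways with distinct weights modulo `W`. -/
theorem Seq.exists_short [Fintype Q] {V : OneVASS Q} {m : ℕ} {s : ℕ → Q} {v : ℕ → ℤ}
    (h : Seq V nn (m + 1) s v)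
    (hnp : ∀ i j, i < j → j ≤ m + 1 → (i ≠ 0 ∨ j ≠ m + 1) → s i = s j → v j ≤ v i)
    (W : ℤ) (K : ℕ) :
    (∃ l, Short V (s 0) (s (m + 1)) (v 0) (v (m + 1))
        (min (m + 1) (Fintype.card Q * K + Fintype.card Q + 1)) l ∧
      W ∣ wt V (s 0) l - (v (m + 1) - v 0)) ∨
    ∃ S : Finset ℤ, K < S.card ∧ ∀ ρ ∈ S, ∃ l, Short V (s 0) (s (m + 1)) (v 0) (v (m + 1))
        (min (m + 1) (Fintype.card Q * K + Fintype.card Q + 1)) l ∧ wt V (s 0) l % W = ρ := by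
  classical
  set κ : ℕ → Q × ℤ := fun j => (s j, v j % W) with hκ
  set cls : ℕ → Q → Finset ℤ := fun j t =>
    ((Finset.Icc j m).filter (fun i => s i = t)).image (fun i => v i % W) with hcls
  have hm := h.take (Nat.le_succ m)
  have hv := h.val m (by omega)
  have hkeys : ∀ i, (∀ t, (cls i t).card ≤ K) →
      ((Finset.Icc i m).image κ).card ≤ Fintype.card Q * K := by
    intro i hi
    have hsub : (Finset.Icc i m).image κ ⊆
        Finset.univ.biUnion fun t => (cls i t).image fun r => (t, r) := by
      intro x hx
      obtain ⟨j, hj, rfl⟩ := Finset.mem_image.1 hx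
      simp only [Finset.mem_biUnion, Finset.mem_univ, true_and, Finset.mem_image]
      exact ⟨s j, v j % W, Finset.mem_image.2 ⟨j, Finset.mem_filter.2 ⟨hj, rfl⟩, rfl⟩, rfl⟩
    refine (Finset.card_le_card hsub).trans (Finset.card_biUnion_le_card_mul _ _ _ fun t _ => ?_)
    exact Finset.card_image_le.trans (hi t)
  have hcomp : ∀ i ≤ m, ∃ l, Short V (s i) (s (m + 1)) (v i) (v (m + 1)) (m - i + 1) l ∧
      W ∣ wt V (s i) l - (v (m + 1) - v i) ∧ l.length ≤ ((Finset.Icc i m).image κ).card := by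
    intro i hi
    obtain ⟨l, h1, h2, h3, h4, h5, h6, -⟩ := hm.compress κ W i hi (by
      intro a b ha hab hb hk
      simp only [hκ, Prod.mk.injEq] at hk
      refine ⟨hk.1, hnp a b hab (by omega) (Or.inr (by omega)) hk.1, ?_⟩
      exact Int.ModEq.dvd hk.2)
    refine ⟨l ++ [s (m + 1)], ⟨runP_append.2 ⟨h1, ?_⟩, by rw [endS_append]; rfl, ?_, ?_⟩, ?_, ?_⟩
    · rw [h2]
      have hn : 0 ≤ v m := hm.inv m le_rfl
      have hn' : 0 ≤ v (m + 1) := h.inv (m + 1) le_rfl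
      refine ⟨?_, h.delta m (by omega), ?_⟩
      · show 0 ≤ _
        omega
      · show 0 ≤ _
        omega
    · rw [wt_append, h2]
      simp only [wt]; omega
    · simp; omega
    · have : wt V (s i) (l ++ [s (m + 1)]) - (v (m + 1) - v i) =
          wt V (s i) l - (v m - v i) := by
        rw [wt_append, h2, hv]; simp only [wt]; ring
      rwa [this]
    · simpa using h5
  by_cases hA : ∀ j ≤ m, ∀ t, (cls j t).card ≤ K
  · left
    obtain ⟨l, ⟨h1, h2, h3, h4⟩, h5, h6⟩ := hcomp 0 (Nat.zero_le _)
    have := hkeys 0 (hA 0 (Nat.zero_le _))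
    exact ⟨l, ⟨h1, h2, h3, le_min (by omega) (by omega)⟩, h5⟩
  · right
    push Not at hA
    obtain ⟨j₀, hj₀, t₀, ht₀⟩ := hA
    obtain ⟨j, hj, hmax⟩ := ((Finset.Icc 0 m).filter fun j => ∃ t, K < (cls j t).card).exists_max_image
      id ⟨j₀, by simp only [Finset.mem_filter, Finset.mem_Icc]; exact ⟨by omega, t₀, ht₀⟩⟩
    simp only [Finset.mem_filter, Finset.mem_Icc, id] at hj hmax
    obtain ⟨⟨-, hjm⟩, t, ht⟩ := hj
    have hnext : ∀ t, (cls (j + 1) t).card ≤ K := by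
      intro t'
      by_contra! hc
      rcases eq_or_lt_of_le hjm with rfl | hlt
      · simp [hcls] at hc
      · have := hmax (j + 1) ⟨by omega, t', hc⟩
        omega
    have hst : s j = t := by
      by_contra hne
      have hsub : cls j t ⊆ cls (j + 1) t := by
        intro x hx
        simp only [hcls, Finset.mem_image, Finset.mem_filter, Finset.mem_Icc] at hx ⊢
        obtain ⟨i, ⟨hi, hit⟩, rfl⟩ := hx
        refine ⟨i, ⟨⟨?_, hi.2⟩, hit⟩, rfl⟩
        rcases eq_or_lt_of_le hi.1 with rfl | hlt
        · exact absurd hit hne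
        · exact hlt
      have := Finset.card_le_card hsub
      have := hnext t
      omega
    have hcard : ((Finset.Icc j m).image κ).card ≤ Fintype.card Q * K + 1 := by
      have hsub : (Finset.Icc j m).image κ ⊆ insert (κ j) ((Finset.Icc (j + 1) m).image κ) := by
        intro x hx
        simp only [Finset.mem_insert, Finset.mem_image, Finset.mem_Icc] at hx ⊢
        obtain ⟨i, hi, rfl⟩ := hx
        rcases eq_or_lt_of_le hi.1 with rfl | hlt
        · exact Or.inl rfl
        · exact Or.inr ⟨i, ⟨hlt, hi.2⟩, rfl⟩
      have h1 := Finset.card_le_card hsub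
      have h2 := Finset.card_insert_le (κ j) ((Finset.Icc (j + 1) m).image κ)
      have h3 := hkeys (j + 1) hnext
      omega
    obtain ⟨α, a1, a2, a3, -, a5, a6, -⟩ := (hm.take hjm).compress s 1 0 (Nat.zero_le _) (by
      intro a b ha hab hb hk
      exact ⟨hk, hnp a b hab (by omega) (Or.inr (by omega)) hk, one_dvd _⟩)
    have hα : ((Finset.Icc 0 j).image s).card ≤ Fintype.card Q := Finset.card_le_univ _
    refine ⟨(cls j t).image fun r => (wt V (s 0) α + v (m + 1) - r) % W, ?_, ?_⟩
    · rwa [Finset.card_image_of_injOn]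
      intro x hx y hy hxy
      simp only [hcls, Finset.coe_image, Set.mem_image] at hx hy
      obtain ⟨i, -, rfl⟩ := hx
      obtain ⟨i', -, rfl⟩ := hy
      have h1 := Int.ModEq.dvd hxy
      have h2 : v i % W ≡ v i' % W [ZMOD W] := by
        refine (Int.modEq_of_dvd ?_).symm
        ring_nf at h1 ⊢
        exact h1
      simpa [Int.ModEq] using h2
    · intro ρ hρ
      simp only [hcls, Finset.mem_image, Finset.mem_filter, Finset.mem_Icc] at hρ
      obtain ⟨_, ⟨i, ⟨hi, hit⟩, rfl⟩, rfl⟩ := hρ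
      obtain ⟨β, hβ, hβd, hβl⟩ := hcomp i hi.2
      have hsub : ((Finset.Icc i m).image κ).card ≤ ((Finset.Icc j m).image κ).card :=
        Finset.card_le_card (Finset.image_subset_image (Finset.Icc_subset_Icc hi.1 le_rfl))
      rw [hit, ← hst] at hβ hβd
      have hvi : v i ≤ v j := by
        rcases eq_or_lt_of_le hi.1 with rfl | hlt
        · exact le_rfl
        · exact hnp j i hlt (by omega) (Or.inr (by omega)) (hst.trans hit.symm)
      have hα' : Short V (s 0) (s j) (v 0) (v j) j α := ⟨a1, a2, by omega, by omega⟩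
      obtain ⟨g1, g2, g3, g4⟩ := hα'.of_append hβ hvi
      refine ⟨α ++ β, ⟨g1, g2, g3, le_min (by omega) ?_⟩, ?_⟩
      · rw [List.length_append]; omega
      · have : wt V (s 0) (α ++ β) ≡ wt V (s 0) α + v (m + 1) - v i % W [ZMOD W] := by
          rw [wt_append, a2]
          refine (Int.modEq_of_dvd ?_).symm
          have h1 : W ∣ v i % W - v i := by
            refine Int.ModEq.dvd ?_
            simp [Int.ModEq]
          have h2 := dvd_add hβd h1
          ring_nf at h2 ⊢
          exact h2
        exact this

/-- The weight of the chosen cycle. -/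
def Wz (V : OneVASS Q) (γ : Q → List Q) (q : Q) : ℤ := pathWeight V (γ q)

/-- The chosen cycle can be validly traversed from the value `y`. -/
def Good (V : OneVASS Q) (γ : Q → List Q) (q : Q) (y : ℤ) : Prop :=
  RunP V (ok V) q (γ q).tail y

/-- Membership in `Conf₊` for integer counter values. -/
def Conf (V : OneVASS Q) (γ : Q → List Q) (q : Q) (y : ℤ) : Prop :=
  q ∈ Qplus V ∧ 0 ≤ y + pmin V (γ q)

/-- Membership in `U n` for integer counter values. -/
def UZ (V : OneVASS Q) (γ : Q → List Q) (n : ℕ) (q : Q) (y : ℤ) : Prop :=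
  0 ≤ y ∧ (q, y.toNat) ∈ U V γ n

/-- The value `y'` is obtained from `y` by validly iterating the chosen cycle. -/
def Link (V : OneVASS Q) (γ : Q → List Q) (q : Q) (y y' : ℤ) : Prop :=
  ∃ k : ℕ, y' = y + k * Wz V γ q ∧ ∀ i : ℕ, i < k → Good V γ q (y + i * Wz V γ q)

theorem le_pmin_iff {V : OneVASS Q} {π : List Q} {x : ℤ} :
    x ≤ pmin V π ↔ x ≤ 0 ∧ ∀ i, i ≤ π.length → x ≤ pathWeight V (π.take i) := by
  have key : ∀ L : List ℤ, x ≤ L.foldr min 0 ↔ x ≤ 0 ∧ ∀ a ∈ L, x ≤ a := by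
    intro L
    induction L with
    | nil => simp
    | cons a L ih => simp only [List.foldr_cons, le_min_iff, ih, List.forall_mem_cons]; tauto
  rw [pmin, key]
  simp only [List.mem_map, List.mem_range, forall_exists_index, and_imp,
    forall_apply_eq_imp_iff₂, Nat.lt_succ_iff]

theorem runP_nn_iff {V : OneVASS Q} {a : Q} {l : List Q} {y : ℤ} :
    RunP V nn a l y ↔ IsPath V (a :: l) ∧ 0 ≤ y + pmin V (a :: l) ∧ 0 ≤ y := by
  rw [runP_iff]
  refine and_congr_right fun _ => ⟨fun h => ?_, fun h i hi => ?_⟩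
  · have h0 : 0 ≤ y := by simpa [pathWeight, nn] using h 0 (by simp)
    refine ⟨?_, h0⟩
    have : -y ≤ pmin V (a :: l) := by
      rw [le_pmin_iff]
      refine ⟨by omega, fun i hi => ?_⟩
      rcases i with _ | i
      · simpa [pathWeight] using h0
      · have h1 : 0 ≤ y + pathWeight V ((a :: l).take (i + 1)) := h i (by omega)
        omega
    omega
  · have := (le_pmin_iff.1 (le_refl (pmin V (a :: l)))).2 (i + 1) (by omega)
    show 0 ≤ _
    omega

theorem Conf.nonneg {V : OneVASS Q} {γ : Q → List Q} {q : Q} {y : ℤ} (h : Conf V γ q y) :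
    0 ≤ y := by
  have := (le_pmin_iff.1 (le_refl (pmin V (γ q)))).1
  have := h.2
  omega

theorem Conf.mono {V : OneVASS Q} {γ : Q → List Q} {q : Q} {y y' : ℤ} (h : Conf V γ q y)
    (hy : y ≤ y') : Conf V γ q y' :=
  ⟨h.1, by have := h.2; omega⟩

theorem conf_iff {V : OneVASS Q} {γ : Q → List Q} {q : Q} {z : ℕ} :
    (q, z) ∈ ConfPlus V γ ↔ Conf V γ q z := Iff.rfl

theorem IsCycleOn.eq_cons {V : OneVASS Q} {q : Q} {π : List Q} (h : IsCycleOn V π q) :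
    π = q :: π.tail ∧ endS q π.tail = q := by
  obtain ⟨-, -, h3, h4⟩ := h
  cases π with
  | nil => simp at h3
  | cons a l =>
    have : a = q := by simpa using h3
    subst this
    rw [getLast?_cons_eq_endS] at h4
    simpa using h4

section
variable {V : OneVASS Q} {γ : Q → List Q}

theorem GammaChoice.eq_cons (hγ : GammaChoice V γ) {q : Q} (hq : q ∈ Qplus V) :
    γ q = q :: (γ q).tail := (hγ q hq).1.1.eq_cons.1

theorem GammaChoice.endS_eq (hγ : GammaChoice V γ) {q : Q} (hq : q ∈ Qplus V) :
    endS q (γ q).tail = q := (hγ q hq).1.1.eq_cons.2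

theorem GammaChoice.wt_eq (hγ : GammaChoice V γ) {q : Q} (hq : q ∈ Qplus V) :
    wt V q (γ q).tail = Wz V γ q := by
  rw [Wz, ← pathWeight_cons, ← hγ.eq_cons hq]

theorem GammaChoice.Wz_pos (hγ : GammaChoice V γ) {q : Q} (hq : q ∈ Qplus V) :
    0 < Wz V γ q := (hγ q hq).2.1

theorem GammaChoice.runP_nn (hγ : GammaChoice V γ) {q : Q} {y : ℤ} (h : Conf V γ q y) :
    RunP V nn q (γ q).tail y := by
  rw [runP_nn_iff, ← hγ.eq_cons h.1]
  exact ⟨(hγ q h.1).1.1.1, h.2, h.nonneg⟩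

theorem GammaChoice.length_le [Fintype Q] (hγ : GammaChoice V γ) {q : Q} (hq : q ∈ Qplus V) :
    (γ q).tail.length ≤ Fintype.card Q := by
  have := (hγ q hq).1.2.length_le_card
  simpa using this

theorem isValidRun_iterCycle_iff {P : Q → ℤ → Prop} {q : Q} {l : List Q} (hl : endS q l = q)
    (k : ℕ) : ∃ l', iterCycle (q :: l) k = q :: l' ∧ endS q l' = q ∧
      wt V q l' = (k + 1) * wt V q l ∧
      ∀ y, RunP V P q l' y ↔ ∀ i : ℕ, i ≤ k → RunP V P q l (y + i * wt V q l) := by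
  induction k with
  | zero => exact ⟨l, rfl, hl, by simp, fun y => by simp⟩
  | succ k ih =>
    obtain ⟨l', h1, h2, h3, h4⟩ := ih
    refine ⟨l' ++ l, by simp [iterCycle, h1], by rw [endS_append, h2, hl], ?_, fun y => ?_⟩
    · rw [wt_append, h2, h3]; push_cast; ring
    · rw [runP_append, h2, h3, h4]
      constructor
      · rintro ⟨h5, h6⟩ i hi
        rcases Nat.lt_succ_iff_lt_or_eq.1 (Nat.lt_succ_iff.2 hi) with hi | rfl
        · exact h5 i (by omega)
        · push_cast; exact h6
      · intro h5
        refine ⟨fun i hi => h5 i (by omega), ?_⟩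
        have := h5 (k + 1) le_rfl
        push_cast at this; exact this

theorem GammaChoice.chainLinked_iff (hγ : GammaChoice V γ) {q : Q} (hq : q ∈ Qplus V) {z z' : ℕ} :
    chainLinked V γ q z z' ↔ (z : ℤ) < z' ∧ Link V γ q z z' := by
  have hW := hγ.Wz_pos hq
  have key : ∀ k : ℕ, (IsValidRun V (iterCycle (γ q) k) z ↔
      ∀ i : ℕ, i ≤ k → Good V γ q (z + i * Wz V γ q)) ∧
      pathWeight V (iterCycle (γ q) k) = (k + 1) * Wz V γ q := by
    intro k
    obtain ⟨l', h1, h2, h3, h4⟩ := isValidRun_iterCycle_iff (V := V) (P := ok V)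
      (hγ.endS_eq hq) k
    rw [hγ.wt_eq hq] at h3 h4
    rw [← hγ.eq_cons hq] at h1
    rw [h1, isValidRun_iff, pathWeight_cons]
    exact ⟨h4 z, h3⟩
  constructor
  · rintro ⟨k, h1, h2⟩
    rw [(key k).1] at h1
    rw [(key k).2] at h2
    refine ⟨by rw [h2]; nlinarith, k + 1, by rw [h2]; push_cast; ring,
      fun i hi => h1 i (by omega)⟩
  · rintro ⟨h0, k, h1, h2⟩
    rcases k with _ | k
    · simp at h1; omega
    · refine ⟨k, (key k).1.2 fun i hi => h2 i (by omega), ?_⟩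
      rw [(key k).2, h1]; push_cast; ring

theorem Link.refl (q : Q) (y : ℤ) : Link V γ q y y := ⟨0, by simp, by simp⟩

theorem Link.trans {q : Q} {x y z : ℤ} (h : Link V γ q x y) (h' : Link V γ q y z) :
    Link V γ q x z := by
  obtain ⟨k, rfl, h2⟩ := h
  obtain ⟨k', rfl, h2'⟩ := h'
  refine ⟨k + k', by push_cast; ring, fun i hi => ?_⟩
  by_cases hik : i < k
  · exact h2 i hik
  · have := h2' (i - k) (by omega)
    rw [Nat.cast_sub (by omega)] at this
    convert this using 1; ring

theorem exists_isChainIn {q : Q} {r : ℕ} {S : Set (Q × ℕ)} (hS : S ⊆ resClass V γ q r)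
    (hc : ChainCond V γ q S) : ∃ C, S ⊆ C ∧ IsChainIn V γ q r C := by
  obtain ⟨C, hSC, hC⟩ := zorn_subset_nonempty
    {S | S ⊆ resClass V γ q r ∧ ChainCond V γ q S} (by
      intro c hc hch hne
      refine ⟨⋃₀ c, ⟨Set.sUnion_subset fun s hs => (hc hs).1, ?_⟩,
        fun s hs => Set.subset_sUnion_of_mem hs⟩
      rintro x ⟨s, hs, hxs⟩ y ⟨t, ht, hyt⟩ hxy
      rcases hch.total hs ht with hst | hst
      · exact (hc ht).2 x (hst hxs) y hyt hxy
      · exact (hc hs).2 x hxs y (hst hyt) hxy) S ⟨hS, hc⟩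
  refine ⟨C, hSC, hC.prop.1, hC.prop.2, fun C' h1 h2 h3 => ?_⟩
  exact Set.Subset.antisymm (hC.le_of_ge ⟨h2, h3⟩ h1) h1

theorem GammaChoice.Wnat_cast (hγ : GammaChoice V γ) {q : Q} (hq : q ∈ Qplus V) :
    (Wnat V γ q : ℤ) = Wz V γ q :=
  Int.toNat_of_nonneg (hγ.Wz_pos hq).le

theorem GammaChoice.mem_U_zero_iff (hγ : GammaChoice V γ) {q : Q} {z : ℕ} :
    (q, z) ∈ U V γ 0 ↔ Conf V γ q z ∧ ∀ k : ℕ, Good V γ q (z + k * Wz V γ q) := by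
  constructor
  · rintro ⟨C, ⟨⟨q', r, hq', hr, hC⟩, hunb⟩, hz⟩
    obtain ⟨hconf, rfl, hzr⟩ := hC.1 hz
    refine ⟨hconf, fun k => ?_⟩
    have hW := hγ.Wz_pos hq'
    simp only [chainBounded, bddAbove_def, not_exists, not_forall, not_le] at hunb
    obtain ⟨_, ⟨c, hc, rfl⟩, hlt⟩ := hunb ((z : ℤ) + k * Wz V γ q).toNat
    have hk : 0 ≤ (k : ℤ) * Wz V γ q := by positivity
    have h1 := hC.2.1 _ hz c hc (by simp only; omega)
    rw [hγ.chainLinked_iff hq'] at h1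
    obtain ⟨-, k', hk', h2⟩ := h1
    refine h2 k ?_
    by_contra! hle
    have : (k' : ℤ) * Wz V γ q ≤ k * Wz V γ q :=
      mul_le_mul_of_nonneg_right (by exact_mod_cast hle) hW.le
    simp only at hk' this hlt
    omega
  · rintro ⟨hconf, hgood⟩
    have hq := hconf.1
    have hW := hγ.Wz_pos hq
    have hWn : 0 < Wnat V γ q := by have := hγ.Wnat_cast hq; omega
    obtain ⟨C, hSC, hC⟩ := exists_isChainIn (V := V) (γ := γ) (q := q) (r := z % Wnat V γ q)
      (S := Set.range fun k : ℕ => (q, z + k * Wnat V γ q)) (by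
        rintro _ ⟨k, rfl⟩
        exact ⟨hconf.mono (by push_cast; simp only [le_add_iff_nonneg_right]; positivity), rfl,
          by simp⟩) (by
        rintro _ ⟨k, rfl⟩ _ ⟨k', rfl⟩ hlt
        simp only at hlt ⊢
        have hkk : k < k' := by
          by_contra! hle
          have := Nat.mul_le_mul_right (Wnat V γ q) hle
          omega
        rw [hγ.chainLinked_iff hq]
        refine ⟨by exact_mod_cast hlt, k' - k, ?_, fun i _ => ?_⟩
        · rw [Nat.cast_sub hkk.le]; push_cast; rw [hγ.Wnat_cast hq]; ring
        · have := hgood (k + i)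
          push_cast at this ⊢
          rw [hγ.Wnat_cast hq]
          convert this using 1; ring)
    refine ⟨C, ⟨⟨q, _, hq, Nat.mod_lt _ hWn, hC⟩, ?_⟩, hSC ⟨0, by simp⟩⟩
    rintro ⟨b, hb⟩
    have h1 := hb ⟨_, hSC ⟨b + 1, rfl⟩, rfl⟩
    simp only at h1
    nlinarith

theorem U_succ_mono (n : ℕ) : U V γ n ⊆ U V γ (n + 1) := fun _ hc _ hS => hS.1 (Or.inl hc)

theorem Uprime_subset (n : ℕ) : Uprime V γ (U V γ n) ⊆ U V γ (n + 1) :=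
  fun _ hc _ hS => hS.1 (Or.inr hc)

theorem U_zero_subset (n : ℕ) : U V γ 0 ⊆ U V γ n := by
  induction n with
  | zero => exact subset_rfl
  | succ n ih => exact ih.trans (U_succ_mono n)

theorem GammaChoice.U_down_step (hγ : GammaChoice V γ) {n : ℕ} {q : Q} {y : ℤ}
    (hy : Conf V γ q y) (hg : Good V γ q y) (h : UZ V γ n q (y + Wz V γ q)) : UZ V γ n q y := by
  have hq := hy.1
  have hW := hγ.Wz_pos hq
  lift y to ℕ using hy.nonneg
  refine ⟨by omega, ?_⟩
  have h2 := h.2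
  rw [← hγ.Wnat_cast hq] at h2
  rw [show ((y : ℤ) + Wnat V γ q).toNat = y + Wnat V γ q by omega] at h2
  rw [Int.toNat_natCast]
  rcases n with _ | n
  · rw [hγ.mem_U_zero_iff] at h2 ⊢
    refine ⟨hy, fun k => ?_⟩
    rcases k with _ | k
    · simpa using hg
    · have := h2.2 k
      push_cast at this ⊢
      rw [hγ.Wnat_cast hq] at this
      convert this using 1; ring
  · intro S hS
    have h3 := h2 S hS
    have hWn : 0 < Wnat V γ q := by have := hγ.Wnat_cast hq; omega
    obtain ⟨C, hSC, hC⟩ := exists_isChainIn (V := V) (γ := γ) (q := q) (r := y % Wnat V γ q)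
      (S := {(q, y), (q, y + Wnat V γ q)}) (by
        rintro _ (rfl | rfl)
        · exact ⟨hy, rfl, rfl⟩
        · exact ⟨hy.mono (by push_cast; omega), rfl, by simp⟩) (by
        rintro _ (rfl | rfl) _ (rfl | rfl) hlt
        · simp at hlt
        · rw [hγ.chainLinked_iff hq]
          refine ⟨by simpa using hWn, 1, by simp [hγ.Wnat_cast hq], fun i hi => ?_⟩
          have : i = 0 := by omega
          subst this
          simpa using hg
        · simp at hlt
        · simp at hlt)
    exact hS.2 C ⟨q, _, hq, Nat.mod_lt _ hWn, hC⟩ _ ⟨h3, hSC (by simp)⟩ _ (hSC (by simp))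
      (by simp)

theorem GammaChoice.U_down (hγ : GammaChoice V γ) {n : ℕ} {q : Q} {y y' : ℤ}
    (hy : Conf V γ q y) (hl : Link V γ q y y') (h : UZ V γ n q y') : UZ V γ n q y := by
  obtain ⟨k, rfl, hk⟩ := hl
  induction k generalizing y with
  | zero => simpa using h
  | succ k ih =>
    have hW := hγ.Wz_pos hy.1
    refine hγ.U_down_step hy (by simpa using hk 0 (by omega)) (ih (hy.mono (by omega)) ?_ ?_)
    · intro i hi
      have := hk (i + 1) (by omega)
      convert this using 1; push_cast; ring
    · convert h using 1; push_cast; ring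

theorem GammaChoice.U_subset_and_succ (hγ : GammaChoice V γ) (n : ℕ) :
    U V γ n ⊆ ConfPlus V γ ∧ ∀ q z, (q, z) ∈ U V γ (n + 1) →
      (q, z) ∈ U V γ n ∨ ∃ d : ℕ, (q, d) ∈ Uprime V γ (U V γ n) ∧ Link V γ q z d := by
  have key : ∀ n, U V γ n ⊆ ConfPlus V γ → U V γ (n + 1) ⊆ {c | c ∈ ConfPlus V γ ∧
      (c ∈ U V γ n ∨ ∃ d : ℕ, (c.1, d) ∈ Uprime V γ (U V γ n) ∧ Link V γ c.1 c.2 d)} := by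
    intro n hn c hc
    refine hc _ ⟨?_, ?_⟩
    · rintro ⟨q, z⟩ (h | h)
      · exact ⟨hn h, Or.inl h⟩
      · exact ⟨h.1.1, Or.inr ⟨z, h, Link.refl _ _⟩⟩
    · rintro C ⟨q, r, hq, -, hC⟩ ⟨q1, z1⟩ ⟨⟨-, hc1⟩, hcC⟩ ⟨q2, z2⟩ hc' hle
      obtain ⟨hconf1, rfl, -⟩ := hC.1 hcC
      obtain ⟨hconf2, hqq, -⟩ := hC.1 hc'
      simp only at hqq hle
      subst hqq
      refine ⟨hconf2, ?_⟩
      have hlink : Link V γ q2 z2 z1 := by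
        rcases eq_or_lt_of_le hle with rfl | hlt
        · exact Link.refl _ _
        · exact ((hγ.chainLinked_iff hq).1 (hC.2.1 _ hc' _ hcC hlt)).2
      rcases hc1 with h | ⟨d, hd, hl⟩
      · left
        have := hγ.U_down (n := n) hconf2 hlink ⟨by simp, by simpa using h⟩
        simpa [UZ] using this
      · exact Or.inr ⟨d, hd, hlink.trans hl⟩
  have hsub : ∀ n, U V γ n ⊆ ConfPlus V γ := by
    intro n
    induction n with
    | zero => exact fun c hc => (hγ.mem_U_zero_iff.1 hc).1
    | succ n ih => exact fun c hc => (key n ih hc).1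
  exact ⟨hsub n, fun q z h => (key n (hsub n) h).2⟩

end

/-- The set `S` has at most `N` elements. -/
def Small (N : ℕ) (S : Set ℤ) : Prop := ∃ F : Finset ℤ, F.card ≤ N ∧ ∀ y ∈ S, y ∈ F

theorem Small.mono {N N' : ℕ} {S S' : Set ℤ} (h : Small N S) (hN : N ≤ N') (hS : S' ⊆ S) :
    Small N' S' := by
  obtain ⟨F, h1, h2⟩ := h
  exact ⟨F, h1.trans hN, fun y hy => h2 y (hS hy)⟩

theorem Small.union {N N' : ℕ} {S S' : Set ℤ} (h : Small N S) (h' : Small N' S') :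
    Small (N + N') (S ∪ S') := by
  obtain ⟨F, h1, h2⟩ := h
  obtain ⟨F', h1', h2'⟩ := h'
  refine ⟨F ∪ F', (Finset.card_union_le _ _).trans (by omega), ?_⟩
  rintro y (hy | hy)
  · exact Finset.mem_union_left _ (h2 y hy)
  · exact Finset.mem_union_right _ (h2' y hy)

theorem Small.biUnion {N : ℕ} {ι : Type} (T : Finset ι) {S : ι → Set ℤ}
    (h : ∀ t ∈ T, Small N (S t)) : Small (T.card * N) (⋃ t ∈ T, S t) := by
  classical
  choose! F h1 h2 using h
  refine ⟨T.biUnion F, Finset.card_biUnion_le_card_mul _ _ _ h1, fun y hy => ?_⟩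
  simp only [Set.mem_iUnion] at hy
  obtain ⟨t, ht, hy⟩ := hy
  exact Finset.mem_biUnion.2 ⟨t, ht, h2 t ht y hy⟩

theorem Small.shift {N : ℕ} {S : Set ℤ} (h : Small N S) (c : ℤ) :
    Small N {y | y + c ∈ S} := by
  obtain ⟨F, h1, h2⟩ := h
  exact ⟨F.image fun x => x - c, Finset.card_image_le.trans h1, fun y hy =>
    Finset.mem_image.2 ⟨y + c, h2 _ hy, by ring⟩⟩

theorem small_of_div_mod {W d : ℤ} (K R : Finset ℤ) {S : Set ℤ}
    (hK : ∀ y ∈ S, (y - d) / W ∈ K) (hR : ∀ y ∈ S, y % W ∈ R) :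
    Small (K.card * R.card) S := by
  refine ⟨(K ×ˢ R).image fun x => d + W * x.1 + (x.2 - d) % W, ?_, fun y hy => ?_⟩
  · exact Finset.card_image_le.trans (Finset.card_product _ _).le
  · refine Finset.mem_image.2 ⟨((y - d) / W, y % W),
      Finset.mem_product.2 ⟨hK y hy, hR y hy⟩, ?_⟩
    simp only
    rw [Int.emod_sub_emod]
    have := Int.mul_ediv_add_emod (y - d) W
    linarith

theorem small_uncovered {Bq Bp D : ℤ → Prop} {G Rq Rp Tp : Finset ℤ} {W Wp d c e a b : ℤ}
    (hW : 0 < W) (hRq : ∀ y, Bq y → y % W ∈ Rq) (hRp : ∀ y, Bp y → y % Wp ∈ Rp)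
    (hφ : ∀ y, d ≤ y → y ∉ G → Bq y → Bp (y + c)) (ha : 0 ≤ a)
    (hab : ∀ k, a ≤ k → k ≤ b → Bq (d + k * W)) (he : Wp ∣ d + c - e) (hec : e ≤ d + c)
    (hD : ∀ u u' y, Bp u → Wp ∣ u - e → e ≤ u → u ≤ y → y ≤ u' →
      (∀ t ∈ Tp, u ≤ t → u' ≤ t) → Bp y → D y) :
    Small ((1 + G.card + Tp.card) * (G.card + Rp.card + 1) * Rq.card)
      {y | Bq y ∧ d + a * W ≤ y ∧ y ≤ d + b * W ∧ y ∉ G ∧ ¬ D (y + c)} := by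
  have hdiv : ∀ y, d + a * W ≤ y → y ≤ d + b * W → a ≤ (y - d) / W ∧ (y - d) / W ≤ b := by
    intro y h1 h2
    refine ⟨(Int.le_ediv_iff_mul_le hW).2 (by linarith), ?_⟩
    exact Int.le_of_lt_add_one ((Int.ediv_lt_iff_lt_mul hW).2 (by nlinarith))
  by_cases hM : b - a + 1 ≤ G.card + Rp.card
  · refine (small_of_div_mod (W := W) (d := d) (Finset.Icc a b) Rq ?_ ?_).mono ?_ subset_rfl
    · rintro y ⟨-, h1, h2, -⟩
      exact Finset.mem_Icc.2 (hdiv y h1 h2)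
    · rintro y ⟨h1, -⟩
      exact hRq y h1
    · refine Nat.mul_le_mul_right _ ?_
      rw [Int.card_Icc]
      have : (b + 1 - a).toNat ≤ 1 * (G.card + Rp.card + 1) := by omega
      exact this.trans (Nat.mul_le_mul_right _ (by omega))
  push Not at hM
  obtain ⟨P, hP0, hPM, hP⟩ : ∃ P : ℤ, 0 < P ∧ P ≤ (G.card + Rp.card + 1 : ℕ) ∧ Wp ∣ P * W := by
    set I := (Finset.Icc a (a + (G.card + Rp.card : ℕ))).filter fun k => d + k * W ∉ G with hI
    have hGI : ((Finset.Icc a (a + (G.card + Rp.card : ℕ))).filter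
        fun k => ¬ d + k * W ∉ G).card ≤ G.card := by
      refine Finset.card_le_card_of_injOn (fun k => d + k * W) (fun k hk => ?_) ?_
      · have := (Finset.mem_filter.1 hk).2
        simpa using this
      · intro k _ k' _ h
        simp only [add_right_inj] at h
        exact mul_right_cancel₀ hW.ne' h
    have hcard := Finset.card_filter_add_card_filter_not
      (s := Finset.Icc a (a + (G.card + Rp.card : ℕ))) (fun k => d + k * W ∉ G)
    rw [Int.card_Icc, ← hI] at hcard
    have hlt : Rp.card < I.card := by omega
    have hmaps : ∀ k ∈ I, (d + k * W + c) % Wp ∈ Rp := by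
      intro k hk
      simp only [hI, Finset.mem_filter, Finset.mem_Icc] at hk
      refine hRp _ (hφ _ ?_ hk.2 (hab k hk.1.1 (by omega)))
      have : 0 ≤ k * W := mul_nonneg (by omega) hW.le
      omega
    obtain ⟨k, hk, k', hk', hne, heq⟩ := Finset.exists_ne_map_eq_of_card_lt_of_maps_to hlt hmaps
    have hd : Wp ∣ (k - k') * W := by
      have := Int.ModEq.dvd (n := Wp) heq.symm
      convert this using 1; ring
    simp only [hI, Finset.mem_filter, Finset.mem_Icc] at hk hk'
    rcases lt_or_gt_of_ne hne with h | h
    · refine ⟨k' - k, by omega, by push_cast at *; omega, ?_⟩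
      rw [show (k' - k) * W = -((k - k') * W) by ring]
      exact (dvd_neg (a := Wp)).2 hd
    · exact ⟨k - k', by omega, by push_cast at *; omega, hd⟩
  have hPW : 0 < P * W := mul_pos hP0 hW
  set J : Finset ℤ := {a / P} ∪ (G.image (fun g => (g - d) / (P * W)) ∪
    Tp.image fun t => (t - d - c) / (P * W)) with hJ
  have hJc : J.card ≤ 1 + G.card + Tp.card := by
    refine (Finset.card_union_le _ _).trans ?_
    have h1 := Finset.card_union_le (G.image fun g => (g - d) / (P * W))
      (Tp.image fun t => (t - d - c) / (P * W))
    have h2 := Finset.card_image_le (s := G) (f := fun g => (g - d) / (P * W))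
    have h3 := Finset.card_image_le (s := Tp) (f := fun t => (t - d - c) / (P * W))
    rw [Finset.card_singleton]; omega
  refine (small_of_div_mod (W := W) (d := d)
    (J.biUnion fun j => Finset.Ico (j * P) (j * P + P)) Rq ?_ ?_).mono ?_ subset_rfl
  · rintro y ⟨hy, h1, h2, hyG, hyD⟩
    set k := (y - d) / W with hk
    obtain ⟨hak, hkb⟩ := hdiv y h1 h2
    have hk1 : k * W ≤ y - d := Int.ediv_mul_le _ hW.ne'
    have hk2 : y - d < (k + 1) * W := Int.lt_ediv_add_one_mul_self _ hW
    set j := k / P with hj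
    have hj1 : j * P ≤ k := Int.ediv_mul_le _ hP0.ne'
    have hj2 : k < (j + 1) * P := Int.lt_ediv_add_one_mul_self _ hP0
    refine Finset.mem_biUnion.2 ⟨j, ?_, Finset.mem_Ico.2 ⟨hj1, by linarith⟩⟩
    by_contra hjJ
    simp only [hJ, Finset.mem_union, Finset.mem_singleton, Finset.mem_image, not_or, not_exists,
      not_and] at hjJ
    obtain ⟨hja, hjG, hjT⟩ := hjJ
    have haj : a ≤ j * P := by
      by_contra! hlt
      refine hja (le_antisymm ((Int.le_ediv_iff_mul_le hP0).2 hlt.le) ?_)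
      exact Int.ediv_le_ediv hP0 hak
    have hjW : 0 ≤ j * P * W := mul_nonneg (by omega) hW.le
    have hu1 : j * P * W ≤ k * W := mul_le_mul_of_nonneg_right hj1 hW.le
    have hu2 : (k + 1) * W ≤ (j + 1) * P * W := mul_le_mul_of_nonneg_right (by omega) hW.le
    have hd0 : d ≤ y := by linarith
    refine hyD (hD (d + j * P * W + c) (d + (j + 1) * P * W + c) (y + c)
      (hφ _ (by linarith) ?_ (hab _ haj (by omega))) ?_ (by linarith) (by linarith) (by linarith)
      ?_ (hφ y hd0 hyG hy))
    · intro hmem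
      refine hjG _ hmem ?_
      rw [show d + j * P * W - d = j * (P * W) by ring]
      exact Int.mul_ediv_cancel _ hPW.ne'
    · rw [show d + j * P * W + c - e = d + c - e + j * (P * W) by ring]
      exact dvd_add he (hP.mul_left j)
    · intro t ht hut
      by_contra! hlt
      refine hjT t ht (le_antisymm ?_ ?_)
      · exact Int.le_of_lt_add_one ((Int.ediv_lt_iff_lt_mul hPW).2 (by linarith))
      · exact (Int.le_ediv_iff_mul_le hPW).2 (by linarith)
  · rintro y ⟨h1, -⟩
    exact hRq y h1
  · refine Nat.mul_le_mul_right _ ?_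
    refine (Finset.card_biUnion_le_card_mul _ _ P.toNat fun j _ => ?_).trans
      (Nat.mul_le_mul hJc (by omega))
    rw [Int.card_Ico]; omega

/-- A configuration of `Conf₊` outside `U n`. -/
def Bad (V : OneVASS Q) (γ : Q → List Q) (n : ℕ) (q : Q) (y : ℤ) : Prop :=
  Conf V γ q y ∧ ¬ UZ V γ n q y

/-- `T q` consists of the values in `Conf₊` where the cycle `γ q` is blocked. -/
structure IsTops (V : OneVASS Q) (γ : Q → List Q) (B : ℕ) (T : Q → Finset ℤ) : Prop where
  mem_iff : ∀ q y, y ∈ T q ↔ Conf V γ q y ∧ ¬ Good V γ q y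
  card_le : ∀ q, (T q).card ≤ B

section
variable {V : OneVASS Q} {γ : Q → List Q} {B : ℕ} {T : Q → Finset ℤ}

theorem exists_isTops [Fintype Q] (hV : SingleGuard V) (hγ : GammaChoice V γ) :
    ∃ T, IsTops V γ (Fintype.card Q + 1) T := by
  classical
  have key : ∀ q, ∃ F : Finset ℤ, (∀ y, y ∈ F ↔ Conf V γ q y ∧ ¬ Good V γ q y) ∧
      F.card ≤ Fintype.card Q + 1 := by
    intro q
    by_cases hq : q ∈ Qplus V
    · obtain ⟨G, hG, h⟩ := exists_blocked hV
        (hγ.runP_nn (q := q) (y := -pmin V (γ q)) ⟨hq, by omega⟩)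
      have := hγ.length_le hq
      refine ⟨G.filter fun y => Conf V γ q y ∧ ¬ Good V γ q y, fun y => ?_,
        (Finset.card_filter_le _ _).trans (by omega)⟩
      rw [Finset.mem_filter, and_iff_right_iff_imp]
      rintro ⟨h1, h2⟩
      by_contra hy
      exact h2 (h y (by have := h1.2; omega) hy)
    · exact ⟨∅, fun y => by simpa using fun h : Conf V γ q y => absurd h.1 hq, by simp⟩
  choose T h1 h2 using key
  exact ⟨T, h1, h2⟩

theorem UZ.succ {n : ℕ} {q : Q} {y : ℤ} (h : UZ V γ n q y) : UZ V γ (n + 1) q y :=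
  ⟨h.1, U_succ_mono n h.2⟩

theorem UZ.of_zero {n : ℕ} {q : Q} {y : ℤ} (h : UZ V γ 0 q y) : UZ V γ n q y :=
  ⟨h.1, U_zero_subset n h.2⟩

theorem GammaChoice.conf_of_UZ (hγ : GammaChoice V γ) {n : ℕ} {q : Q} {y : ℤ}
    (h : UZ V γ n q y) : Conf V γ q y := by
  have h1 := (hγ.U_subset_and_succ n).1 h.2
  rw [conf_iff, Int.toNat_of_nonneg h.1] at h1
  exact h1

theorem GammaChoice.UZ_zero_iff (hγ : GammaChoice V γ) {q : Q} {y : ℤ} :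
    UZ V γ 0 q y ↔ Conf V γ q y ∧ ∀ k : ℕ, Good V γ q (y + k * Wz V γ q) := by
  constructor
  · rintro ⟨h0, h⟩
    rw [hγ.mem_U_zero_iff, Int.toNat_of_nonneg h0] at h
    exact h
  · intro h
    refine ⟨h.1.nonneg, ?_⟩
    rw [hγ.mem_U_zero_iff, Int.toNat_of_nonneg h.1.nonneg]
    exact h

theorem Link.dvd {q : Q} {y t : ℤ} (h : Link V γ q y t) : Wz V γ q ∣ t - y := by
  obtain ⟨k, rfl, -⟩ := h
  exact ⟨k, by ring⟩

theorem Link.le (hγ : GammaChoice V γ) {q : Q} (hq : q ∈ Qplus V) {y t : ℤ}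
    (h : Link V γ q y t) : y ≤ t := by
  obtain ⟨k, rfl, -⟩ := h
  have := mul_nonneg (Int.natCast_nonneg k) (hγ.Wz_pos hq).le
  omega

theorem Link.mid (hγ : GammaChoice V γ) {q : Q} (hq : q ∈ Qplus V) {x y z : ℤ}
    (h : Link V γ q x z) (hxy : x ≤ y) (hyz : y ≤ z) (hd : Wz V γ q ∣ y - x) :
    Link V γ q x y ∧ Link V γ q y z := by
  have hW := hγ.Wz_pos hq
  obtain ⟨k, rfl, hk⟩ := h
  obtain ⟨j, hj⟩ := hd
  have hj0 : 0 ≤ j := by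
    by_contra! hlt
    nlinarith
  lift j to ℕ using hj0
  have hjk : j ≤ k := by
    by_contra! hlt
    have : (k : ℤ) + 1 ≤ j := by exact_mod_cast hlt
    nlinarith
  have hy : y = x + j * Wz V γ q := by linarith
  subst hy
  refine ⟨⟨j, rfl, fun i hi => hk i (by omega)⟩, k - j, ?_, fun i hi => ?_⟩
  · rw [Nat.cast_sub hjk]; ring
  · have := hk (j + i) (by omega)
    push_cast at this
    convert this using 1; ring

theorem Bad.exists_top (hγ : GammaChoice V γ) (hT : IsTops V γ B T) {n : ℕ} {q : Q} {y : ℤ}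
    (h : Bad V γ n q y) : ∃ t ∈ T q, Link V γ q y t := by
  classical
  have hex : ∃ k : ℕ, ¬ Good V γ q (y + k * Wz V γ q) := by
    by_contra! hall
    exact h.2 (hγ.UZ_zero_iff.2 ⟨h.1, hall⟩).of_zero
  have hW := hγ.Wz_pos h.1.1
  refine ⟨y + (Nat.find hex : ℕ) * Wz V γ q, (hT.mem_iff _ _).2 ⟨h.1.mono ?_, Nat.find_spec hex⟩,
    _, rfl, fun i hi => not_not.1 (Nat.find_min hex hi)⟩
  have := mul_nonneg (Int.natCast_nonneg (Nat.find hex)) hW.le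
  omega

/-- The residues of the blocked values. -/
def topRes (V : OneVASS Q) (γ : Q → List Q) (T : Q → Finset ℤ) (q : Q) : Finset ℤ :=
  (T q).image fun t => t % Wz V γ q

theorem IsTops.card_topRes_le (hT : IsTops V γ B T) (q : Q) : (topRes V γ T q).card ≤ B :=
  Finset.card_image_le.trans (hT.card_le q)

theorem Bad.mod_mem (hγ : GammaChoice V γ) (hT : IsTops V γ B T) {n : ℕ} {q : Q} {y : ℤ}
    (h : Bad V γ n q y) : y % Wz V γ q ∈ topRes V γ T q := by
  obtain ⟨t, ht, hl⟩ := h.exists_top hγ hT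
  exact Finset.mem_image.2 ⟨t, ht, ((Int.modEq_iff_dvd.2 hl.dvd : y ≡ t [ZMOD Wz V γ q])).symm⟩

/-- Either many residues are reachable from almost every value above `v 0`, so that `U 0` is
reached, or one short path works for almost all values. -/
theorem Seq.escape [Fintype Q] (hV : SingleGuard V) (hγ : GammaChoice V γ)
    (hT : IsTops V γ B T) {m L : ℕ} {s : ℕ → Q} {v : ℕ → ℤ} (h : Seq V nn (m + 1) s v)
    (hnp : ∀ i j, i < j → j ≤ m + 1 → (i ≠ 0 ∨ j ≠ m + 1) → s i = s j → v j ≤ v i)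
    (he : Conf V γ (s (m + 1)) (v (m + 1)))
    (hL : L = Fintype.card Q * B + Fintype.card Q + 1) :
    (∃ G : Finset ℤ, G.card ≤ (B + 1) * (L + 1) ∧ ∀ y, v 0 ≤ y → y ∉ G →
      ∃ l, RunP V (ok V) (s 0) l y ∧ endS (s 0) l = s (m + 1) ∧ l.length ≤ min (m + 1) L ∧
        UZ V γ 0 (s (m + 1)) (y + wt V (s 0) l)) ∨
    ∃ (l : List Q) (G : Finset ℤ), G.card ≤ L + 1 ∧
      (∀ y, v 0 ≤ y → y ∉ G → RunP V (ok V) (s 0) l y) ∧ endS (s 0) l = s (m + 1) ∧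
      l.length ≤ min (m + 1) L ∧ v (m + 1) ≤ v 0 + wt V (s 0) l ∧
      Wz V γ (s (m + 1)) ∣ wt V (s 0) l - (v (m + 1) - v 0) := by
  classical
  rcases h.exists_short hnp (Wz V γ (s (m + 1))) B with ⟨l, ⟨h1, h2, h3, h4⟩, h5⟩ | ⟨S, hS, hSl⟩
  · right
    obtain ⟨G, hG, hr⟩ := exists_blocked hV h1
    rw [← hL] at h4
    exact ⟨l, G, hG.trans (by omega), hr, h2, h4, h3, h5⟩
  · left
    obtain ⟨S', hS', hc⟩ := Finset.exists_subset_card_eq (s := S) (n := B + 1) (by omega)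
    have hSl' : ∀ ρ ∈ S', ∃ (l : List Q) (G : Finset ℤ), G.card ≤ L + 1 ∧
        (∀ y, v 0 ≤ y → y ∉ G → RunP V (ok V) (s 0) l y) ∧ endS (s 0) l = s (m + 1) ∧
        l.length ≤ min (m + 1) L ∧ v (m + 1) ≤ v 0 + wt V (s 0) l ∧
        wt V (s 0) l % Wz V γ (s (m + 1)) = ρ := by
      intro ρ hρ
      obtain ⟨l, ⟨h1, h2, h3, h4⟩, h5⟩ := hSl ρ (hS' hρ)
      obtain ⟨G, hG, hr⟩ := exists_blocked hV h1
      rw [← hL] at h4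
      exact ⟨l, G, hG.trans (by omega), hr, h2, h4, h3, h5⟩
    choose! l G hG hrun hend hlen hval hmod using hSl'
    refine ⟨S'.biUnion G, (Finset.card_biUnion_le_card_mul _ _ _ hG).trans (by rw [hc]),
      fun y hy hyG => ?_⟩
    obtain ⟨ρ, hρ, hρn⟩ : ∃ ρ ∈ S',
        (y + wt V (s 0) (l ρ)) % Wz V γ (s (m + 1)) ∉ topRes V γ T (s (m + 1)) := by
      by_contra! hall
      obtain ⟨ρ, hρ, ρ', hρ', hne, heq⟩ := Finset.exists_ne_map_eq_of_card_lt_of_maps_to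
        (by have := hT.card_topRes_le (s (m + 1)); omega) hall
      refine hne ?_
      rw [← hmod ρ hρ, ← hmod ρ' hρ']
      exact Int.ModEq.add_left_cancel' y heq
    refine ⟨l ρ, hrun ρ hρ y hy fun hm => hyG (Finset.mem_biUnion.2 ⟨ρ, hρ, hm⟩), hend ρ hρ,
      hlen ρ hρ, ?_⟩
    by_contra hU
    exact hρn (Bad.mod_mem hγ hT (n := 0) ⟨he.mono (by have := hval ρ hρ; omega), hU⟩)

end

/-- A positive cycle along a run yields a configuration of `Conf₊`. -/
theorem Seq.exists_conf {V : OneVASS Q} {γ : Q → List Q} (hγ : GammaChoice V γ) {m : ℕ}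
    {s : ℕ → Q} {v : ℕ → ℤ} (h : Seq V nn m s v) {i j : ℕ} (hij : i < j) (hj : j ≤ m)
    (hs : s i = s j) (hv : v i < v j) :
    ∃ i' j', i ≤ i' ∧ i' < j' ∧ j' ≤ j ∧ Conf V γ (s i') (v i') ∧ Conf V γ (s j') (v j') := by
  classical
  induction hk : j - i using Nat.strong_induction_on generalizing i j with
  | _ k ih =>
  by_cases hex : ∃ a b, i ≤ a ∧ a < b ∧ b ≤ j ∧ b - a < k ∧ s a = s b ∧ v a < v b
  · obtain ⟨a, b, ha, hab, hb, hlt, hsab, hvab⟩ := hex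
    obtain ⟨i', j', h1, h2, h3, h4⟩ := ih (b - a) hlt hab (by omega) hsab hvab rfl
    exact ⟨i', j', by omega, h2, by omega, h4⟩
  · push Not at hex
    obtain ⟨l, h1, h2, h3, -, -, -, -, h8⟩ := (h.take (m' := j - 1) (by omega)).compress s 1 i
      (by omega) fun a b ha hab hb hsab =>
        ⟨hsab, hex a b ha hab (by omega) (by omega) hsab, one_dvd _⟩
    have hd := h.delta (j - 1) (by omega)
    have hvj := h.val (j - 1) (by omega)
    have hnj := h.inv j hj
    rw [Nat.sub_add_cancel (by omega)] at hd hvj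
    have hw : v j - v i ≤ wt V (s i) (l ++ [s j]) := by
      rw [wt_append, h2]; simp only [wt]; omega
    have hrun : RunP V nn (s i) (l ++ [s j]) (v i) := by
      rw [runP_append, h2]
      refine ⟨h1, le_trans (h.inv (j - 1) (by omega)) (by omega), hd,
        le_trans hnj (by omega)⟩
    obtain ⟨hpath, hpm, -⟩ := runP_nn_iff.1 hrun
    have hcyc : IsSimpleCycleOn V (s i :: (l ++ [s j])) (s i) := by
      refine ⟨⟨hpath, by simp, rfl, ?_⟩, ?_⟩
      · rw [getLast?_cons_eq_endS, endS_append, hs]; rfl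
      · rw [← List.cons_append, List.dropLast_concat]
        exact h8 fun _ _ => id
    have hpos : 0 < pathWeight V (s i :: (l ++ [s j])) := by
      rw [pathWeight_cons]; omega
    have hQ : s i ∈ Qplus V := ⟨_, hcyc, hpos⟩
    have hconf : Conf V γ (s i) (v i) := ⟨hQ, by have := (hγ _ hQ).2.2 _ hcyc hpos; omega⟩
    exact ⟨i, j, le_rfl, hij, le_rfl, hconf, hs ▸ hconf.mono hv.le⟩

section
variable {V : OneVASS Q} {γ : Q → List Q}

/-- The path `q :: l` is a valid run from the value `y` into `U n`. -/
def RunInto (V : OneVASS Q) (γ : Q → List Q) (n : ℕ) (q : Q) (y : ℤ) (l : List Q) : Prop :=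
  RunP V (ok V) q l y ∧ UZ V γ n (endS q l) (y + wt V q l)

theorem runLenTo_iff {n : ℕ} {q : Q} {z k : ℕ} :
    RunLenTo V (q, z) (U V γ n) k ↔ ∃ l, RunInto V γ n q z l ∧ l.length = k := by
  constructor
  · rintro ⟨π, ⟨p, e⟩, hU, hv, hft, hl⟩
    cases π with
    | nil => simp at hl
    | cons a l =>
      rw [runFromTo_iff] at hft
      obtain ⟨rfl, h2, h3⟩ := hft
      simp only at h2 h3 hv
      refine ⟨l, ⟨isValidRun_iff.1 hv, ?_⟩, by simpa using hl⟩
      rw [← h3, h2]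
      exact ⟨by omega, by simpa using hU⟩
  · rintro ⟨l, ⟨h1, h2⟩, h3⟩
    refine ⟨q :: l, _, h2.2, isValidRun_iff.2 h1, runFromTo_iff.2 ⟨rfl, rfl, ?_⟩, by simp [h3]⟩
    exact Int.toNat_of_nonneg h2.1

theorem GammaChoice.exists_seq_of_Uprime (hγ : GammaChoice V γ) {n : ℕ} {q : Q} {d : ℕ}
    (hd : (q, d) ∈ Uprime V γ (U V γ n)) :
    ∃ m s v, Seq V (ok V) (m + 1) s v ∧ s 0 = q ∧ v 0 = d ∧ UZ V γ n (s (m + 1)) (v (m + 1)) ∧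
      (∀ i j, i < j → j ≤ m + 1 → (i ≠ 0 ∨ j ≠ m + 1) → s i = s j → v j ≤ v i) ∧
      ∀ q' y' l, Conf V γ q' y' → RunInto V γ n q' y' l → l.length ≤ m + 1 →
        UZ V γ (n + 1) q' y' := by
  obtain ⟨⟨hconf, hnU⟩, k, hk, hmin⟩ := hd
  have hmin' : ∀ q' y' l, Conf V γ q' y' → ¬ UZ V γ n q' y' → RunInto V γ n q' y' l →
      k ≤ l.length := by
    intro q' y' l hc hU hl
    lift y' to ℕ using hc.nonneg
    exact hmin (q', y') ⟨hc, fun h => hU ⟨by omega, by simpa using h⟩⟩ _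
      (runLenTo_iff.2 ⟨l, hl, rfl⟩)
  have hnU' : ¬ UZ V γ n q d := fun h => hnU (by simpa using h.2)
  obtain ⟨l, ⟨hl1, hl2⟩, hl3⟩ := runLenTo_iff.1 hk
  obtain ⟨m, rfl⟩ : ∃ m, k = m + 1 := by
    refine Nat.exists_eq_succ_of_ne_zero ?_
    rintro rfl
    obtain rfl := List.length_eq_zero_iff.1 hl3
    exact hnU' (by simpa [endS, wt] using hl2)
  obtain ⟨s, v, hs, hs0, hv0, hsm, hvm, -⟩ := hl1.exists_seq
  rw [hl3] at hs hsm hvm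
  rw [← hsm, ← hvm] at hl2
  refine ⟨m, s, v, hs, hs0, hv0, hl2, ?_, ?_⟩
  · intro i j hij hj hor hsij
    by_contra! hlt
    obtain ⟨i', j', h1, h2, h3, h4, h5⟩ :=
      (hs.imp (P' := nn) fun _ _ h => h.1).exists_conf hγ hij hj hsij hlt
    obtain ⟨x, hx0, hxm, hx⟩ : ∃ x, 0 < x ∧ x < m + 1 ∧ Conf V γ (s x) (v x) := by
      by_cases hi' : i' = 0
      · exact ⟨j', by omega, by omega, h5⟩
      · exact ⟨i', by omega, by omega, h4⟩
    by_cases hU : UZ V γ n (s x) (v x)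
    · obtain ⟨l', e1, e2, e3, e4⟩ := (hs.take hxm.le).exists_run
      have := hmin' _ _ l' (by rw [hs0, hv0]; exact hconf) (by rw [hs0, hv0]; exact hnU')
        ⟨e1, by rw [e2, e3]; simpa using hU⟩
      omega
    · obtain ⟨l', e1, e2, e3, e4⟩ := (hs.shift hxm.le).exists_run
      simp only [add_zero, Nat.add_sub_cancel' hxm.le] at e1 e2 e3
      have := hmin' _ _ l' hx hU ⟨e1, by rw [e2, e3]; simpa using hl2⟩
      omega
  · intro q' y' l' hc hl' hlen
    by_contra hU
    have hU' : ¬ UZ V γ n q' y' := fun h => hU h.succ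
    lift y' to ℕ using hc.nonneg
    refine hU ⟨by omega, Uprime_subset n ⟨⟨hc, fun h => hU' ⟨by omega, h⟩⟩,
      l'.length, runLenTo_iff.2 ⟨l', by simpa using hl', rfl⟩, ?_⟩⟩
    rintro ⟨q2, y2⟩ ⟨hc2, hU2⟩ j hj
    exact hlen.trans (hmin _ ⟨hc2, hU2⟩ _ hj)

end

theorem dvd_sub_trans {w a b c : ℤ} (h : w ∣ a - b) (h' : w ∣ b - c) : w ∣ a - c := by
  simpa using dvd_add h h'

section
variable {V : OneVASS Q} {γ : Q → List Q} {B : ℕ} {T : Q → Finset ℤ}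

/-- The blocked value `t` lies above some value of `U n` in its residue class. -/
def Act (V : OneVASS Q) (γ : Q → List Q) (T : Q → Finset ℤ) (n : ℕ) (q : Q) (t : ℤ) : Prop :=
  t ∈ T q ∧ ∃ c ≤ t, Wz V γ q ∣ t - c ∧ UZ V γ n q c

/-- The values outside `U n` lying in the hull of an active segment in the residue class
of `e`. -/
def Delta (V : OneVASS Q) (γ : Q → List Q) (T : Q → Finset ℤ) (n : ℕ) (q : Q) (e y : ℤ) : Prop :=
  Bad V γ n q y ∧ ∃ t, Act V γ T n q t ∧ Wz V γ q ∣ t - e ∧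
    (∃ x, Bad V γ n q x ∧ Link V γ q x t ∧ x ≤ y) ∧ y ≤ t

open Classical in
/-- The number of active blocked configurations. -/
noncomputable def numAct [Fintype Q] (V : OneVASS Q) (γ : Q → List Q) (T : Q → Finset ℤ)
    (n : ℕ) : ℕ :=
  ∑ q, ((T q).filter (Act V γ T n q)).card

theorem numAct_le [Fintype Q] (hT : IsTops V γ B T) (n : ℕ) :
    numAct V γ T n ≤ Fintype.card Q * B := by
  classical
  refine (Finset.sum_le_card_nsmul _ _ B fun q _ =>
    (Finset.card_filter_le _ _).trans (hT.card_le q)).trans ?_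
  simp

theorem Act.succ {n : ℕ} {q : Q} {t : ℤ} (h : Act V γ T n q t) : Act V γ T (n + 1) q t := by
  obtain ⟨h1, c, h2, h3, h4⟩ := h
  exact ⟨h1, c, h2, h3, h4.succ⟩

theorem numAct_mono [Fintype Q] (n : ℕ) : numAct V γ T n ≤ numAct V γ T (n + 1) := by
  classical
  refine Finset.sum_le_sum fun q _ => Finset.card_le_card fun t ht => ?_
  rw [Finset.mem_filter] at ht ⊢
  exact ⟨ht.1, ht.2.succ⟩

theorem numAct_lt [Fintype Q] {n : ℕ} {q : Q} {t : ℤ} (h : Act V γ T (n + 1) q t)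
    (h' : ¬ Act V γ T n q t) : numAct V γ T n + 1 ≤ numAct V γ T (n + 1) := by
  classical
  refine Finset.sum_lt_sum (fun q _ => Finset.card_le_card fun t ht => ?_)
    ⟨q, Finset.mem_univ _, Finset.card_lt_card ?_⟩
  · rw [Finset.mem_filter] at ht ⊢
    exact ⟨ht.1, ht.2.succ⟩
  · refine (Finset.ssubset_iff_of_subset fun t ht => ?_).2 ⟨t, ?_, ?_⟩
    · rw [Finset.mem_filter] at ht ⊢
      exact ⟨ht.1, ht.2.succ⟩
    · exact Finset.mem_filter.2 ⟨h.1, h⟩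
    · exact fun hm => h' (Finset.mem_filter.1 hm).2

theorem GammaChoice.not_act_zero (hγ : GammaChoice V γ) (hT : IsTops V γ B T) {q : Q} {t : ℤ} :
    ¬ Act V γ T 0 q t := by
  rintro ⟨ht, c, hct, ⟨k, hk⟩, hc⟩
  obtain ⟨hconf, hgood⟩ := hγ.UZ_zero_iff.1 hc
  have hW := hγ.Wz_pos hconf.1
  have hk0 : 0 ≤ k := by
    by_contra! hlt
    nlinarith
  lift k to ℕ using hk0
  refine ((hT.mem_iff _ _).1 ht).2 ?_
  have := hgood k
  rwa [show c + k * Wz V γ q = t by linarith] at this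

/-- The number of new elements of the hulls when one more chain becomes active. -/
def stepBound (B L : ℕ) : ℕ :=
  (B + 1) * (L + 1) + ((L + 1) + B * ((1 + (L + 1) + B) * (L + 1 + B + 1) * B))

theorem GammaChoice.small_delta_succ [Fintype Q] (hV : SingleGuard V) (hγ : GammaChoice V γ)
    (hT : IsTops V γ B T) {L : ℕ} (hL : L = Fintype.card Q * B + Fintype.card Q + 1) {n N : ℕ}
    (ih : ∀ q e, Small N {y | Delta V γ T n q e y}) {q : Q} {e c₀ : ℤ} {d : ℕ}
    (hce : Wz V γ q ∣ c₀ - e) (hc₀ : UZ V γ (n + 1) q c₀)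
    (hmin : ∀ c, UZ V γ (n + 1) q c → Wz V γ q ∣ c - e → c₀ ≤ c)
    (hd : (q, d) ∈ Uprime V γ (U V γ n)) (hlink : Link V γ q c₀ d) :
    Small (N + stepBound B L) {y | Delta V γ T (n + 1) q e y} := by
  have hconf : Conf V γ q d := hd.1.1
  have hq := hconf.1
  have hW := hγ.Wz_pos hq
  have hdU : UZ V γ (n + 1) q d := ⟨by omega, by simpa using Uprime_subset n hd⟩
  have hcd := Link.le hγ hq hlink
  have hhull : ∀ t x, Act V γ T (n + 1) q t → Wz V γ q ∣ t - e → Bad V γ (n + 1) q x →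
      Link V γ q x t → d < x ∧ Wz V γ q ∣ x - d := by
    rintro t x ⟨-, c, hct, hdc, hc⟩ hte hx hxt
    have hxe : Wz V γ q ∣ x - e :=
      dvd_sub_trans (dvd_sub_comm.1 hxt.dvd) hte
    have hc0t : c₀ ≤ t :=
      (hmin c hc (dvd_sub_trans (dvd_sub_comm.1 hdc) hte)).trans hct
    have hxd : Wz V γ q ∣ x - d :=
      dvd_sub_trans (dvd_sub_trans hxe (dvd_sub_comm.1 hce)) (dvd_sub_comm.1 hlink.dvd)
    refine ⟨?_, hxd⟩
    by_contra! hle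
    rcases le_or_gt x c₀ with h | h
    · refine hx.2 (hγ.U_down hx.1 (hxt.mid hγ hq h hc0t ?_).1 hc₀)
      exact dvd_sub_trans hce (dvd_sub_comm.1 hxe)
    · refine hx.2 (hγ.U_down hx.1 (hlink.mid hγ hq h.le hle ?_).2 hdU)
      exact dvd_sub_trans hxe (dvd_sub_comm.1 hce)
  have hge : ∀ y, Delta V γ T (n + 1) q e y → (d : ℤ) ≤ y := by
    rintro y ⟨-, t, ht, hte, ⟨x, hx, hxt, hxy⟩, -⟩
    exact ((hhull t x ht hte hx hxt).1.le).trans hxy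
  obtain ⟨m, s, v, hs, hs0, hv0, hUend, hnp, hinto⟩ := hγ.exists_seq_of_Uprime hd
  have hend := hγ.conf_of_UZ hUend
  rcases (hs.imp (P' := nn) fun _ _ h => h.1).escape hV hγ hT hnp hend hL with
    ⟨G, hG, hrun⟩ | ⟨l, G, hG, hrun, hl, hlen, hval, hdvd⟩
  · rw [hs0, hv0] at hrun
    refine ⟨G, hG.trans (by rw [stepBound]; omega), fun y hy => ?_⟩
    by_contra hyG
    obtain ⟨l, h1, h2, h3, h4⟩ := hrun y (hge y hy) hyG
    exact hy.1.2 (hinto q y l hy.1.1 ⟨h1, h2 ▸ h4.of_zero⟩ (by omega))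
  rw [hs0] at hl hval hdvd hrun
  rw [hv0] at hval hdvd hrun
  set p := s (m + 1) with hp
  set e' := v (m + 1) with he'
  have hφ : ∀ y, (d : ℤ) ≤ y → y ∉ G → Bad V γ (n + 1) q y → Bad V γ n p (y + wt V q l) := by
    intro y hy hyG hb
    refine ⟨hend.mono (by omega), fun hU => hb.2 ?_⟩
    exact hinto q y l hb.1 ⟨hrun y hy hyG, hl ▸ hU⟩ (by omega)
  have hunc : ∀ t ∈ T q, Small ((1 + (L + 1) + B) * (L + 1 + B + 1) * B)
      {y | Bad V γ (n + 1) q y ∧ (Act V γ T (n + 1) q t ∧ Wz V γ q ∣ t - e) ∧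
        (∃ x, Bad V γ (n + 1) q x ∧ Link V γ q x t ∧ x ≤ y) ∧ y ≤ t ∧ y ∉ G ∧
          ¬ Delta V γ T n p e' (y + wt V q l)} := by
    intro t ht
    by_cases hne : (Act V γ T (n + 1) q t ∧ Wz V γ q ∣ t - e) ∧
        ∃ x, Bad V γ (n + 1) q x ∧ Link V γ q x t
    swap
    · exact ⟨∅, by simp, fun y hy => absurd ⟨hy.2.1, hy.2.2.1.imp fun x hx => ⟨hx.1, hx.2.1⟩⟩ hne⟩
    obtain ⟨⟨hact, hte⟩, hx⟩ := hne
    obtain ⟨x, ⟨hxb, hxt⟩, hxmin⟩ := Int.exists_least_of_bdd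
      ⟨0, fun x (hx : Bad V γ (n + 1) q x ∧ Link V γ q x t) => hx.1.1.nonneg⟩ hx
    obtain ⟨hdx, a, ha⟩ := hhull t x hact hte hxb hxt
    obtain ⟨k, hk, -⟩ := id hxt
    have ha0 : 0 ≤ a := by
      by_contra! hlt
      nlinarith
    have hxa : x = d + a * Wz V γ q := by linarith
    have htb : t = d + (a + k) * Wz V γ q := by rw [hk, hxa]; ring
    refine (small_uncovered (Bq := Bad V γ (n + 1) q) (Bp := Bad V γ n p)
      (D := Delta V γ T n p e') (G := G) (Rq := topRes V γ T q) (Rp := topRes V γ T p)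
      (Tp := T p) (W := Wz V γ q) (Wp := Wz V γ p) (d := d) (c := wt V q l) (e := e') (a := a)
      (b := a + k) hW (fun y hy => hy.mod_mem hγ hT) (fun y hy => hy.mod_mem hγ hT) hφ ha0
      ?_ ?_ hval ?_).mono ?_ ?_
    · intro i hai hik
      have h1 : a * Wz V γ q ≤ i * Wz V γ q := mul_le_mul_of_nonneg_right hai hW.le
      have h2 : i * Wz V γ q ≤ (a + k) * Wz V γ q := mul_le_mul_of_nonneg_right hik hW.le
      refine ⟨hconf.mono (by nlinarith), fun hU => hxb.2 (hγ.U_down hxb.1 (hxt.mid hγ hq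
        (by omega) (by omega) ⟨i - a, ?_⟩).1 hU)⟩
      rw [hxa]; ring
    · convert hdvd using 1; ring
    · intro u u' y hu hue heu huy hyu' htop hy
      obtain ⟨t', ht', hlt⟩ := hu.exists_top hγ hT
      have hut := Link.le hγ hu.1.1 hlt
      have hte' : Wz V γ p ∣ t' - e' :=
        dvd_sub_trans hlt.dvd hue
      exact ⟨hy, t', ⟨ht', e', by omega, hte', hUend⟩, hte', ⟨u, hu, hlt, huy⟩,
        hyu'.trans (htop t' ht' hut)⟩
    · have h1 := hT.card_topRes_le q
      have h2 := hT.card_topRes_le p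
      have h3 := hT.card_le p
      gcongr
    · rintro y ⟨hy, -, ⟨x', hx', hxt', hxy⟩, hyt, hyG, hyD⟩
      refine ⟨hy, ?_, htb ▸ hyt, hyG, hyD⟩
      rw [← hxa]
      exact (hxmin x' ⟨hx', hxt'⟩).trans hxy
  have hGs : Small (L + 1) (G : Set ℤ) := ⟨G, hG, fun y hy => hy⟩
  refine (((ih p e').shift (wt V q l)).union (hGs.union (Small.biUnion (T q) hunc))).mono ?_ ?_
  · have h1 := Nat.mul_le_mul_right ((1 + (L + 1) + B) * (L + 1 + B + 1) * B) (hT.card_le q)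
    rw [stepBound]
    omega
  · rintro y ⟨hy, t, ht, hte, hx, hyt⟩
    by_cases h1 : Delta V γ T n p e' (y + wt V q l)
    · exact Or.inl h1
    by_cases h2 : y ∈ G
    · exact Or.inr (Or.inl h2)
    · refine Or.inr (Or.inr ?_)
      simp only [Set.mem_iUnion]
      exact ⟨t, ht.1, hy, ⟨ht, hte⟩, hx, hyt, h2, h1⟩

theorem GammaChoice.small_delta [Fintype Q] (hV : SingleGuard V) (hγ : GammaChoice V γ)
    (hT : IsTops V γ B T) {L : ℕ} (hL : L = Fintype.card Q * B + Fintype.card Q + 1) (n : ℕ)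
    (q : Q) (e : ℤ) :
    Small (numAct V γ T n * stepBound B L) {y | Delta V γ T n q e y} := by
  induction n generalizing q e with
  | zero =>
    refine ⟨∅, by simp, ?_⟩
    rintro y ⟨-, t, ht, -⟩
    exact absurd ht (hγ.not_act_zero hT)
  | succ n ih =>
    have hmono := numAct_mono (V := V) (γ := γ) (T := T) n
    by_cases hex : ∃ c, UZ V γ (n + 1) q c ∧ Wz V γ q ∣ c - e
    swap
    · refine ⟨∅, by simp, ?_⟩
      rintro y ⟨-, t, ⟨-, c, -, hdc, hc⟩, hte, -⟩
      refine absurd ⟨c, hc, ?_⟩ hex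
      exact dvd_sub_trans (dvd_sub_comm.1 hdc) hte
    obtain ⟨c₀, ⟨hc₀, hce⟩, hmin⟩ := Int.exists_least_of_bdd
      ⟨0, fun c (hc : UZ V γ (n + 1) q c ∧ Wz V γ q ∣ c - e) => hc.1.1⟩ hex
    by_cases hc₀n : UZ V γ n q c₀
    · refine (ih q e).mono (Nat.mul_le_mul_right _ hmono) ?_
      rintro y ⟨hy, t, ⟨ht, c, hct, hdc, hc⟩, hte, ⟨x, hx, hxt, hxy⟩, hyt⟩
      refine ⟨⟨hy.1, fun h => hy.2 h.succ⟩, t, ⟨ht, c₀, ?_, ?_, hc₀n⟩, hte,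
        ⟨x, ⟨hx.1, fun h => hx.2 h.succ⟩, hxt, hxy⟩, hyt⟩
      · refine (hmin c ⟨hc, ?_⟩).trans hct
        exact dvd_sub_trans (dvd_sub_comm.1 hdc) hte
      · exact dvd_sub_trans hte (dvd_sub_comm.1 hce)
    · rcases (hγ.U_subset_and_succ n).2 q _ hc₀.2 with h | ⟨d, hd, hlink⟩
      · exact absurd ⟨hc₀.1, h⟩ hc₀n
      rw [Int.toNat_of_nonneg hc₀.1] at hlink
      have hcc := hγ.conf_of_UZ hc₀
      obtain ⟨t, ht, hct⟩ := Bad.exists_top hγ hT ⟨hcc, hc₀n⟩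
      have hle := Link.le hγ hcc.1 hct
      have hlt := numAct_lt (T := T) (n := n) (t := t) ⟨ht, c₀, hle, hct.dvd, hc₀⟩ (by
        rintro ⟨-, c, hc1, hdc, hc⟩
        have hdc' : Wz V γ q ∣ c - c₀ :=
          dvd_sub_trans (dvd_sub_comm.1 hdc) hct.dvd
        refine hc₀n (hγ.U_down hcc (hct.mid hγ hcc.1 (hmin c ⟨hc.succ, ?_⟩) hc1 hdc').1 hc)
        exact dvd_sub_trans hdc' hce)
      refine (hγ.small_delta_succ hV hT hL ih hce hc₀ (fun c h1 h2 => hmin c ⟨h1, h2⟩)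
        hd hlink).mono ?_ subset_rfl
      have := Nat.mul_le_mul_right (stepBound B L) hlt
      rw [add_mul, one_mul] at this
      exact this

/-- Few configurations above a configuration of `U n` in its residue class lie outside `U n`. -/
theorem GammaChoice.small_bad_above [Fintype Q] (hV : SingleGuard V) (hγ : GammaChoice V γ)
    (hT : IsTops V γ B T) {L : ℕ} (hL : L = Fintype.card Q * B + Fintype.card Q + 1) {n : ℕ}
    {q : Q} {e : ℤ} (he : UZ V γ n q e) :
    Small (Fintype.card Q * B * stepBound B L)
      {y | e ≤ y ∧ Wz V γ q ∣ y - e ∧ ¬ UZ V γ n q y} := by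
  refine (hγ.small_delta hV hT hL n q e).mono (Nat.mul_le_mul_right _ (numAct_le hT n)) ?_
  rintro y ⟨hey, hd, hU⟩
  have hb : Bad V γ n q y := ⟨(hγ.conf_of_UZ he).mono hey, hU⟩
  obtain ⟨t, ht, hyt⟩ := hb.exists_top hγ hT
  have hle := Link.le hγ hb.1.1 hyt
  have hte : Wz V γ q ∣ t - e :=
    dvd_sub_trans hyt.dvd hd
  exact ⟨hb, t, ⟨ht, e, by omega, hte, he⟩, hte, ⟨y, hb, hyt, le_rfl⟩, hle⟩

end

section
variable {V : OneVASS Q} {γ : Q → List Q} {B : ℕ} {T : Q → Finset ℤ}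

/-- Either the end of a run is reachable by a short run, or short runs reach many
configurations along it. -/
theorem Seq.reach_or_many {m : ℕ} {s : ℕ → Q} {v : ℕ → ℤ} (h : Seq V (ok V) m s v) (M : ℕ) :
    (∃ l, RunP V (ok V) (s 0) l (v 0) ∧ endS (s 0) l = s m ∧ v 0 + wt V (s 0) l = v m ∧
      l.length ≤ M) ∨
    ∃ J : Finset ℕ, J.card = M + 1 ∧ Set.InjOn (fun j => (s j, v j)) J ∧
      ∀ j ∈ J, j < m ∧ ∃ l, RunP V (ok V) (s 0) l (v 0) ∧ endS (s 0) l = s j ∧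
        v 0 + wt V (s 0) l = v j ∧ l.length ≤ M := by
  classical
  set R : ℕ → ℕ → Prop := fun M j => ∃ l, RunP V (ok V) (s 0) l (v 0) ∧ endS (s 0) l = s j ∧
    v 0 + wt V (s 0) l = v j ∧ l.length ≤ M with hR
  have hmono : ∀ M j, R M j → R (M + 1) j := by
    rintro M j ⟨l, h1, h2, h3, h4⟩
    exact ⟨l, h1, h2, h3, by omega⟩
  have hR0 : R 0 0 := ⟨[], h.inv 0 (by omega), rfl, by simp [wt], le_rfl⟩
  change R M m ∨ ∃ J : Finset ℕ, J.card = M + 1 ∧ Set.InjOn (fun j => (s j, v j)) J ∧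
    ∀ j ∈ J, j < m ∧ R M j
  induction M with
  | zero =>
    rcases Nat.eq_zero_or_pos m with rfl | hm
    · exact Or.inl hR0
    · exact Or.inr ⟨{0}, rfl, by simp, fun j hj => by
        obtain rfl := Finset.mem_singleton.1 hj
        exact ⟨hm, hR0⟩⟩
  | succ M ih =>
    by_cases hM : R (M + 1) m
    · exact Or.inl hM
    rcases ih with h1 | ⟨J, hJ, hinj, hJR⟩
    · exact absurd (hmono _ _ h1) hM
    right
    obtain ⟨j, hj, hmax⟩ := ((Finset.range (m + 1)).filter (R M)).exists_max_image id
      (by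
        obtain ⟨j, hj⟩ := Finset.card_pos.1 (by omega : 0 < J.card)
        exact ⟨j, Finset.mem_filter.2 ⟨Finset.mem_range.2 (by have := (hJR j hj).1; omega),
          (hJR j hj).2⟩⟩)
    simp only [Finset.mem_filter, Finset.mem_range, id] at hj hmax
    have hjm : j < m := by
      rcases Nat.lt_or_ge j m with hlt | hge
      · exact hlt
      · obtain rfl : j = m := by omega
        exact absurd (hmono _ _ hj.2) hM
    have hRj : R (M + 1) (j + 1) := by
      obtain ⟨l, h1, h2, h3, h4⟩ := hj.2
      have hv := h.val j hjm
      refine ⟨l ++ [s (j + 1)], runP_append.2 ⟨h1, ?_⟩, by rw [endS_append]; rfl, ?_,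
        by simp [h4]⟩
      · rw [h2, h3]
        refine ⟨h.inv j hjm.le, h.delta j hjm, ?_⟩
        have := h.inv (j + 1) hjm
        rwa [hv] at this
      · rw [wt_append, h2, hv, ← h3]
        simp only [wt]; ring
    have hnew : ∀ i ∈ J, (s i, v i) ≠ (s (j + 1), v (j + 1)) := by
      intro i hi heq
      obtain ⟨e1, e2⟩ := Prod.mk.inj heq
      obtain ⟨l, h1, h2, h3, h4⟩ := (hJR i hi).2
      have := hmax (j + 1) ⟨by omega, l, h1, by rw [h2, e1], by rw [h3, e2], h4⟩
      omega
    have hnotMem : j + 1 ∉ J := fun hm => hnew _ hm rfl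
    refine ⟨insert (j + 1) J, by rw [Finset.card_insert_of_notMem hnotMem, hJ], ?_, ?_⟩
    · rw [Finset.coe_insert, Set.injOn_insert (by simpa using hnotMem)]
      refine ⟨hinj, ?_⟩
      rintro ⟨i, hi, heq⟩
      exact hnew i hi heq
    · intro i hi
      rcases Finset.mem_insert.1 hi with rfl | hi
      · refine ⟨lt_of_le_of_ne hjm ?_, hRj⟩
        rintro heq
        exact hM (heq ▸ hRj)
      · exact ⟨(hJR i hi).1, hmono _ _ (hJR i hi).2⟩

/-- Among many positions with the same state, either one reaches `U 0` quickly, or a single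
short path leads from almost all of them to the last state. -/
theorem Seq.escape_of_many [Fintype Q] (hV : SingleGuard V) (hγ : GammaChoice V γ)
    (hT : IsTops V γ B T) {m L : ℕ} {s : ℕ → Q} {v : ℕ → ℤ} (h : Seq V nn m s v)
    (hnp : ∀ i j, i < j → j ≤ m → (i ≠ 0 ∨ j ≠ m) → s i = s j → v j ≤ v i)
    (he : Conf V γ (s m) (v m)) (hL : L = Fintype.card Q * B + Fintype.card Q + 1) {t : Q}
    {J : Finset ℕ} (hJ : ∀ j ∈ J, j < m ∧ s j = t) (hinj : Set.InjOn v J)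
    (hcard : (B + 1) * (L + 1) < J.card) :
    (∃ j ∈ J, ∃ l, RunP V (ok V) t l (v j) ∧ endS t l = s m ∧ l.length ≤ L ∧
      UZ V γ 0 (s m) (v j + wt V t l)) ∨
    ∃ i ∈ J, ∃ (l : List Q) (G : Finset ℤ), (∀ j ∈ J, v i ≤ v j) ∧ G.card ≤ L + 1 ∧
      (∀ j ∈ J, v j ∉ G → RunP V (ok V) t l (v j)) ∧ endS t l = s m ∧ l.length ≤ L ∧
      v m ≤ v i + wt V t l ∧ Wz V γ (s m) ∣ wt V t l - (v m - v i) := by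
  classical
  obtain ⟨i, hi, hmin⟩ := J.exists_min_image v (Finset.card_pos.1 (by omega))
  obtain ⟨him, rfl⟩ := hJ i hi
  obtain ⟨k, hk⟩ : ∃ k, m - i = k + 1 := ⟨m - i - 1, by omega⟩
  have hs := h.shift him.le
  have hend : i + (k + 1) = m := by omega
  rw [hk] at hs
  have hesc := hs.escape (L := L) hV hγ hT (fun a b hab hb hor hsab => hnp (i + a) (i + b)
    (by omega) (by omega) (by omega) hsab) (by simpa only [hend] using he) hL
  simp only [hend, add_zero] at hesc
  rcases hesc with ⟨G, hG, hrun⟩ | ⟨l, G, hG, hrun, h1, h2, h3, h4⟩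
  · left
    obtain ⟨j, hj, hjG⟩ : ∃ j ∈ J, v j ∉ G := by
      by_contra! hall
      have := Finset.card_le_card_of_injOn v hall hinj
      omega
    obtain ⟨l, e1, e2, e3, e4⟩ := hrun (v j) (hmin j hj) hjG
    exact ⟨j, hj, l, e1, e2, by omega, e4⟩
  · exact Or.inr ⟨i, hi, l, G, hmin, hG, fun j hj hjG => hrun _ (hmin j hj) hjG, h1, by omega,
      h3, h4⟩

/-- The number of values in one residue class that suffices to reach `U n`. -/
def classBound (k B L : ℕ) : ℕ :=
  (B + 1) * (L + 1) + (L + 1) + k * B * stepBound B L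

theorem Seq.exists_short_into [Fintype Q] (hV : SingleGuard V) (hγ : GammaChoice V γ)
    (hT : IsTops V γ B T) {m L n : ℕ} {s : ℕ → Q} {v : ℕ → ℤ} (h : Seq V (ok V) m s v)
    (hnp : ∀ i j, i < j → j ≤ m → (i ≠ 0 ∨ j ≠ m) → s i = s j → v j ≤ v i)
    (he : UZ V γ n (s m) (v m)) (hL : L = Fintype.card Q * B + Fintype.card Q + 1) :
    ∃ l, RunInto V γ n (s 0) (v 0) l ∧ endS (s 0) l = s m ∧
      l.length ≤ Fintype.card Q * (classBound (Fintype.card Q) B L * (L + 1 + B)) + L := by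
  classical
  set N₁ := classBound (Fintype.card Q) B L with hN₁
  rcases h.reach_or_many (Fintype.card Q * (N₁ * (L + 1 + B))) with
    ⟨l, h1, h2, h3, h4⟩ | ⟨J, hJ, hinj, hJR⟩
  · exact ⟨l, ⟨h1, by rw [h2, h3]; exact he⟩, h2, by omega⟩
  suffices hsuff : ∃ j ∈ J, ∃ l, RunInto V γ n (s j) (v j) l ∧ endS (s j) l = s m ∧
      l.length ≤ L by
    obtain ⟨j, hj, l', ⟨e1, e2⟩, e3, e4⟩ := hsuff
    obtain ⟨-, l, h1, h2, h3, h4⟩ := hJR j hj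
    refine ⟨l ++ l', ⟨runP_append.2 ⟨h1, ?_⟩, ?_⟩, by rw [endS_append, h2, e3],
      by rw [List.length_append]; omega⟩
    · rw [h2, h3]; exact e1
    · rw [endS_append, wt_append, h2, ← add_assoc, h3]; exact e2
  have hnn := h.imp (P' := nn) fun _ _ h => h.1
  have hend := hγ.conf_of_UZ he
  have hN₁' : (B + 1) * (L + 1) ≤ N₁ := by rw [hN₁, classBound]; omega
  obtain ⟨t, -, ht⟩ := Finset.exists_lt_card_fiber_of_mul_lt_card_of_maps_to
    (s := J) (t := Finset.univ) (f := s) (n := N₁ * (L + 1 + B)) (fun _ _ => Finset.mem_univ _)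
    (by rw [Finset.card_univ]; omega)
  set Jt := J.filter fun j => s j = t with hJt
  have hJt' : ∀ j ∈ Jt, j ∈ J ∧ j < m ∧ s j = t := fun j hj =>
    ⟨(Finset.mem_filter.1 hj).1, (hJR j (Finset.mem_filter.1 hj).1).1, (Finset.mem_filter.1 hj).2⟩
  have hinjt : Set.InjOn v Jt := by
    intro i hi j hj hij
    refine hinj (hJt' i hi).1 (hJt' j hj).1 (Prod.ext ?_ hij)
    exact (hJt' i hi).2.2.trans (hJt' j hj).2.2.symm
  suffices hsuff : ∃ j ∈ Jt, ∃ l, RunInto V γ n t (v j) l ∧ endS t l = s m ∧ l.length ≤ L by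
    obtain ⟨j, hj, l, hl⟩ := hsuff
    obtain ⟨h1, -, rfl⟩ := hJt' j hj
    exact ⟨j, h1, l, hl⟩
  set W := Wz V γ (s m) with hW
  by_cases hres : (Jt.image fun j => v j % W).card ≤ L + 1 + B
  · obtain ⟨r, -, hr⟩ := Finset.exists_lt_card_fiber_of_mul_lt_card_of_maps_to
      (s := Jt) (t := Jt.image fun j => v j % W) (f := fun j => v j % W) (n := N₁)
      (fun j hj => Finset.mem_image_of_mem _ hj)
      (lt_of_le_of_lt (by rw [mul_comm]; exact Nat.mul_le_mul_left _ hres) ht)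
    set Jr := Jt.filter fun j => v j % W = r with hJr
    have hJr' : ∀ j ∈ Jr, j ∈ Jt ∧ v j % W = r := fun j hj => Finset.mem_filter.1 hj
    have hinjr : Set.InjOn v Jr := hinjt.mono fun j hj => (hJr' j hj).1
    rcases hnn.escape_of_many hV hγ hT hnp hend hL
      (fun j hj => (hJt' j (hJr' j hj).1).2) hinjr (by omega) with
      ⟨j, hj, l, h1, h2, h3, h4⟩ | ⟨i, hi, l, G, hmin, hG, hrun, h1, h2, h3, h4⟩
    · exact ⟨j, (hJr' j hj).1, l, ⟨h1, h2 ▸ h4.of_zero⟩, h2, h3⟩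
    obtain ⟨F, hF, hFm⟩ := hγ.small_bad_above hV hT hL he
    obtain ⟨j, hj, hjG⟩ : ∃ j ∈ Jr, v j ∉ G ∪ F.image fun x => x - wt V t l := by
      by_contra! hall
      have e1 := Finset.card_le_card_of_injOn v hall hinjr
      have e2 := Finset.card_union_le G (F.image fun x => x - wt V t l)
      have e3 := Finset.card_image_le (s := F) (f := fun x => x - wt V t l)
      rw [hN₁, classBound] at hr
      omega
    rw [Finset.mem_union, not_or] at hjG
    refine ⟨j, (hJr' j hj).1, l, ⟨hrun j hj hjG.1, ?_⟩, h1, h2⟩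
    rw [h1]
    by_contra hU
    refine hjG.2 (Finset.mem_image.2 ⟨v j + wt V t l, hFm _ ⟨?_, ?_, hU⟩, by ring⟩)
    · have := hmin j hj
      omega
    · have e1 : W ∣ v j - v i :=
        Int.ModEq.dvd (n := W) ((hJr' i hi).2.trans (hJr' j hj).2.symm)
      rw [show v j + wt V t l - v m = v j - v i + (wt V t l - (v m - v i)) by ring]
      exact dvd_add e1 h4
  · push Not at hres
    have hc : N₁ < Jt.card := lt_of_le_of_lt (Nat.le_mul_of_pos_right _ (by omega)) ht
    rcases hnn.escape_of_many hV hγ hT hnp hend hL (fun j hj => (hJt' j hj).2) hinjt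
      (by omega) with
      ⟨j, hj, l, h1, h2, h3, h4⟩ | ⟨i, hi, l, G, hmin, hG, hrun, h1, h2, h3, h4⟩
    · exact ⟨j, hj, l, ⟨h1, h2 ▸ h4.of_zero⟩, h2, h3⟩
    by_contra! hall
    have hsub : (Jt.image fun j => v j % W) ⊆ (G.image fun x => x % W) ∪
        (topRes V γ T (s m)).image fun x => (x - wt V t l) % W := by
      intro x hx
      obtain ⟨j, hj, rfl⟩ := Finset.mem_image.1 hx
      rw [Finset.mem_union]
      by_cases hjG : v j ∈ G
      · exact Or.inl (Finset.mem_image_of_mem _ hjG)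
      right
      have hb : Bad V γ n (s m) (v j + wt V t l) := by
        refine ⟨hend.mono (by have := hmin j hj; omega), fun hU => ?_⟩
        have := hall j hj l ⟨hrun j hj hjG, by rw [h1]; exact hU⟩ h1
        omega
      refine Finset.mem_image.2 ⟨_, hb.mod_mem hγ hT, ?_⟩
      rw [Int.emod_sub_emod, add_sub_cancel_right]
    have e1 := Finset.card_le_card hsub
    have e2 := Finset.card_union_le (G.image fun x => x % W)
      ((topRes V γ T (s m)).image fun x => (x - wt V t l) % W)
    have e3 := Finset.card_image_le (s := G) (f := fun x => x % W)
    have e4 := Finset.card_image_le (s := topRes V γ T (s m))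
      (f := fun x => (x - wt V t l) % W)
    have e5 := hT.card_topRes_le (s m)
    omega

end

open Polynomial in
theorem exists_polynomial_bound : ∃ p : Polynomial ℕ, ∀ k B L : ℕ, B = k + 1 →
    L = k * B + k + 1 → p.eval k = k * (classBound k B L * (L + 1 + B)) + L := by
  set B : ℕ[X] := X + 1 with hB
  set L : ℕ[X] := X * B + X + 1 with hL
  set S : ℕ[X] := (B + 1) * (L + 1) +
    ((L + 1) + B * ((1 + (L + 1) + B) * (L + 1 + B + 1) * B)) with hS
  refine ⟨X * (((B + 1) * (L + 1) + (L + 1) + X * B * S) * (L + 1 + B)) + L, ?_⟩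
  rintro k b l rfl rfl
  simp [hS, hL, hB, classBound, stepBound]

/-- Proposition 9: there is a polynomial `p` such that if a configuration of
`Conf₊` has a valid primitive run to `U_n`, then it has a valid run of length at most `p(|Q|)`
(i.e. at most `p(|Q|) + 1` states) to `U_n`, ending in the same state. -/
theorem short_valid_run_to_U :
    ∃ p : Polynomial ℕ,
      ∀ (Q : Type) [Fintype Q] (V : OneVASS Q), SingleGuard V →
        ∀ γ : Q → List Q, GammaChoice V γ →
          ∀ (q q' : Q) (z z' : ℕ) (n : ℕ) (π : List Q),
            (q, z) ∈ ConfPlus V γ → (q', z') ∈ ConfPlus V γ →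
            IsValidRun V π z → RunFromTo V π (q, z) (q', z') → Primitive V π →
            (q', z') ∈ U V γ n →
            ∃ π' z'', IsValidRun V π' z ∧ RunFromTo V π' (q, z) (q', z'') ∧
              (q', z'') ∈ U V γ n ∧
              π'.length ≤ p.eval (Fintype.card Q) + 1 := by
  obtain ⟨p, hp⟩ := exists_polynomial_bound
  refine ⟨p, ?_⟩
  intro Q _ V hV γ hγ q q' z z' n π _ _ hrun hft hprim hU
  obtain ⟨T, hT⟩ := exists_isTops hV hγ
  rw [hp _ _ _ rfl rfl]
  cases π with
  | nil => exact absurd hrun.1.1 id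
  | cons a l =>
    rw [runFromTo_iff] at hft
    obtain ⟨rfl, hend, hval⟩ := hft
    simp only at hend hval
    obtain ⟨s, v, hs, hs0, hv0, hsm, hvm, hinf⟩ := (isValidRun_iff.1 hrun).exists_seq
    rw [hend] at hsm
    rw [← hval] at hvm
    have hnp : ∀ i j, i < j → j ≤ l.length → (i ≠ 0 ∨ j ≠ l.length) → s i = s j →
        v j ≤ v i := by
      intro i j hij hj hor hsij
      by_contra! hlt
      obtain ⟨h1, h2, h3, h4⟩ := hinf i j hij.le hj
      refine hprim i (j - i + 1) (fun heq => ?_) ⟨by omega, by rw [h2, h3, hsij], by omega⟩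
      rw [heq, List.length_cons] at h4
      omega
    obtain ⟨l', ⟨h1, h2⟩, h3, h4⟩ := hs.exists_short_into hV hγ hT hnp
      (n := n) (by rw [hsm, hvm]; exact ⟨by omega, by simpa using hU⟩) rfl
    rw [hs0, hv0] at h1 h2
    rw [hs0, hsm] at h3
    rw [h3] at h2
    refine ⟨_ :: l', _, isValidRun_iff.2 h1, runFromTo_iff.2 ⟨rfl, h3, ?_⟩, h2.2, ?_⟩
    · exact Int.toNat_of_nonneg h2.1
    · rw [List.length_cons]
      omega
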